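/- arXiv:1607.01377 — 2 statements merged into one kernel-verified Lean document; each statement's English description precedes it below -/
import Mathlib

section
/- Suppose H is an algebraic k-hypergraph and δ = dep(H). If δ < ω, then δ is the least δ' for which there is a d-dimensional k-template P with e(P) = δ'+1 such that L(ℝ^d,P) is embeddable into H. If δ = ∞, then there is no d-dimensional k-template P such that L(ℝ^d,P) is embeddable into H. -/
open Cardinal

universe u v

/-- `f` is one-to-one in each coordinate: if `a` and `b` differ in exactly one
coordinate, then `f a ≠ f b`. -/
def OneToOneEachCoord {d : ℕ} {X C : Type*} (f : (Fin d → X) → C) : Prop :=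
  ∀ a b : Fin d → X, (∃ i, a i ≠ b i ∧ ∀ j, j ≠ i → a j = b j) → f a ≠ f b

/-- `Q` is a homomorphic image of the template `P`: there is a surjection of `P`
onto `Q` preserving coordinate equalities. -/
def IsHomImage {d : ℕ} {α β : Type*} (P : Finset (Fin d → α)) (Q : Finset (Fin d → β)) : Prop :=
  ∃ f : (Fin d → α) → (Fin d → β),
    (∀ x ∈ P, f x ∈ Q) ∧ (∀ y ∈ Q, ∃ x ∈ P, f x = y) ∧
    (∀ x ∈ P, ∀ y ∈ P, ∀ i, x i = y i → f x i = f y i)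

/-- The edge set of the template hypergraph `L(X^d, P)`: the edges are the
`k`-element subsets of `X^d` that are homomorphic images of `P`. -/
def LEdges (k : ℕ) {d : ℕ} {α : Type*} (P : Finset (Fin d → α)) (X : Type*) :
    Set (Finset (Fin d → X)) :=
  {Q | Q.card = k ∧ IsHomImage P Q}

/-- Image of a finset (with classical decidable equality). -/
noncomputable def fimg {V W : Type*} (g : V → W) (e : Finset V) : Finset W :=
  @Finset.image _ _ (Classical.decEq W) g e

/-- `g` is an embedding of the hypergraph with edge set `E₁` into the one with
edge set `E₂`: an injection on vertices mapping every edge to an edge. -/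
def IsHGEmbedding {V W : Type*} (E₁ : Set (Finset V)) (E₂ : Set (Finset W)) (g : V → W) : Prop :=
  Function.Injective g ∧ ∀ e ∈ E₁, fimg g e ∈ E₂

def Embeddable {V W : Type*} (E₁ : Set (Finset V)) (E₂ : Set (Finset W)) : Prop :=
  ∃ g, IsHGEmbedding E₁ E₂ g

/-- The hypergraph with edge set `E` has a coloring with at most `κ` colors
that is not constant on any edge. -/
def ProperlyColorable {V : Type u} (E : Set (Finset V)) (κ : Cardinal.{u}) : Prop :=
  ∃ (C : Type u) (φ : V → C), #C ≤ κ ∧ ∀ e ∈ E, ∃ x ∈ e, ∃ y ∈ e, φ x ≠ φ y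

/-- The chromatic number: the least `κ` admitting a proper `κ`-coloring. -/
noncomputable def chromaticNumber {V : Type u} (E : Set (Finset V)) : Cardinal.{u} :=
  sInf {κ | ProperlyColorable E κ}

/-- The edge set of the zero `k`-hypergraph of a `(k,n)`-ary real polynomial:
the `k`-element subsets of `ℝ^n` admitting an enumeration on which `p` vanishes. -/
def zeroEdges (k n : ℕ) (p : MvPolynomial (Fin k × Fin n) ℝ) : Set (Finset (Fin n → ℝ)) :=
  {s | ∃ a : Fin k → (Fin n → ℝ), Function.Injective a ∧
        fimg a Finset.univ = s ∧ MvPolynomial.eval (fun v => a v.1 v.2) p = 0}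

/-- `I` is a distinguisher for the template `P`: any two distinct elements of `P`
differ at some coordinate in `I`. -/
def IsDistinguisher {d : ℕ} {α : Type*} (P : Finset (Fin d → α)) (I : Finset (Fin d)) : Prop :=
  ∀ x ∈ P, ∀ y ∈ P, x ≠ y → ∃ i ∈ I, x i ≠ y i

/-- `e(P)`: the least cardinality of a distinguisher for `P`. -/
noncomputable def eT {d : ℕ} {α : Type*} (P : Finset (Fin d → α)) : ℕ :=
  sInf {e | ∃ I : Finset (Fin d), IsDistinguisher P I ∧ I.card = e}

/-- The set of `δ < ω` witnessing the depth of a `k`-hypergraph: there is a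
`d`-dimensional `k`-template `P` with `e(P) = δ + 1` such that `L(M^d, P)` is
embeddable into the hypergraph for every `M < ω`.  The depth `dep(H)` is the
least element of this set, and is `∞` exactly when this set is empty. -/
def DepthSet (k : ℕ) {V : Type*} (E : Set (Finset V)) : Set ℕ :=
  {δ | ∃ (d : ℕ) (α : Type) (P : Finset (Fin d → α)), P.card = k ∧ eT P = δ + 1 ∧
       ∀ M : ℕ, Embeddable (LEdges k P (Fin M)) E}

section

/-- The iterated product of a nonprincipal ultrafilter on `ℕ` with itself, as an ultrafilter on
`Fin s → ℕ`. -/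
noncomputable def iterUltra : (s : ℕ) → Ultrafilter (Fin s → ℕ)
  | 0 => pure Fin.elim0
  | s + 1 => (Filter.hyperfilter ℕ).bind fun m =>
      (iterUltra s).map fun θ => (Fin.cons m θ : Fin (s + 1) → ℕ)

theorem eventually_iterUltra_succ {s : ℕ} {A : (Fin (s + 1) → ℕ) → Prop} :
    (∀ᶠ θ in (iterUltra (s + 1) : Filter _), A θ) ↔
      ∀ᶠ m in (Filter.hyperfilter ℕ : Filter ℕ), ∀ᶠ θ in (iterUltra s : Filter _),
        A (Fin.cons m θ) := by
  rw [iterUltra]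
  rfl

theorem eventually_iterUltra_comp {r s : ℕ} (f : Fin r ↪o Fin s) {A : (Fin r → ℕ) → Prop} :
    (∀ᶠ θ in (iterUltra s : Filter _), A (θ ∘ f)) ↔ ∀ᶠ θ in (iterUltra r : Filter _), A θ := by
  induction s generalizing r with
  | zero =>
    obtain rfl : r = 0 := by simpa using Fintype.card_le_of_injective f f.injective
    refine Filter.eventually_congr (Filter.Eventually.of_forall fun θ => ?_)
    rw [Subsingleton.elim (θ ∘ f) θ]
  | succ s ih =>
    rcases r with _ | r
    · have h1 : ∀ θ : Fin (s + 1) → ℕ, θ ∘ f = Fin.elim0 := fun θ => Subsingleton.elim _ _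
      have h2 : ∀ θ : Fin 0 → ℕ, θ = Fin.elim0 := fun θ => Subsingleton.elim _ _
      rw [Filter.eventually_congr (Filter.Eventually.of_forall fun θ => iff_of_eq
        (congrArg A (h1 θ))), Filter.eventually_congr (Filter.Eventually.of_forall fun θ =>
        iff_of_eq (congrArg A (h2 θ)))]
      simp
    · by_cases h0 : f 0 = 0
      · have hne : ∀ i : Fin r, f i.succ ≠ 0 := fun i h => by
          have := f.injective (h.trans h0.symm)
          exact Fin.succ_ne_zero i this
        let f' : Fin r ↪o Fin s := OrderEmbedding.ofStrictMono (fun i => (f i.succ).pred (hne i))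
          fun i j hij => by
            rw [Fin.pred_lt_pred_iff]
            exact f.strictMono (Fin.succ_lt_succ_iff.2 hij)
        have hc : ∀ (m : ℕ) (θ : Fin s → ℕ),
            (Fin.cons m θ : Fin (s + 1) → ℕ) ∘ f = Fin.cons m (θ ∘ f') := by
          intro m θ
          funext i
          refine Fin.cases ?_ (fun i => ?_) i
          · simp [h0]
          · rw [Function.comp_apply, Fin.cons_succ, ← Fin.succ_pred (f i.succ) (hne i),
              Fin.cons_succ]
            rfl
        simp only [eventually_iterUltra_succ, hc]
        exact Filter.eventually_congr (Filter.Eventually.of_forall fun m =>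
          ih f' (A := fun θ => A (Fin.cons m θ)))
      · have hne : ∀ i, f i ≠ 0 := fun i h => h0 <| le_antisymm
          (h ▸ f.monotone (Fin.zero_le i)) (Fin.zero_le _)
        let f' : Fin (r + 1) ↪o Fin s := OrderEmbedding.ofStrictMono (fun i => (f i).pred (hne i))
          fun i j hij => by
            rw [Fin.pred_lt_pred_iff]
            exact f.strictMono hij
        have hc : ∀ (m : ℕ) (θ : Fin s → ℕ),
            (Fin.cons m θ : Fin (s + 1) → ℕ) ∘ f = θ ∘ f' := by
          intro m θ
          funext i
          rw [Function.comp_apply, ← Fin.succ_pred (f i) (hne i), Fin.cons_succ]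
          rfl
        rw [eventually_iterUltra_succ]
        simp only [hc, ih f', Filter.eventually_const]

/-- On functions from a linear order to `ℕ` there is an ultrafilter which is increasing and
whose restrictions to finite subsets depend only on their cardinality. -/
theorem exists_indiscernible_ultrafilter (L : Type*) [LinearOrder L] :
    ∃ W : Ultrafilter (L → ℕ),
      (∀ (s : ℕ) (e e' : Fin s ↪o L) (A : (Fin s → ℕ) → Prop),
        (∀ᶠ θ in (W : Filter (L → ℕ)), A (θ ∘ e)) → ∀ᶠ θ in (W : Filter (L → ℕ)), A (θ ∘ e')) ∧
      ∀ a b : L, a < b → ∀ᶠ θ in (W : Filter (L → ℕ)), θ a < θ b := by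
  let N : Finset L → Filter (L → ℕ) := fun S =>
    Filter.comap (fun θ => θ ∘ S.orderEmbOfFin rfl) (iterUltra S.card)
  have hmono : ∀ S T : Finset L, S ⊆ T → N T ≤ N S := by
    intro S T hST A hA
    obtain ⟨B, hB, hBA⟩ := hA
    let f : Fin S.card ↪o Fin T.card := OrderEmbedding.ofStrictMono
      (fun i => (T.orderIsoOfFin rfl).symm ⟨S.orderEmbOfFin rfl i,
        hST (S.orderEmbOfFin_mem rfl i)⟩) fun i j hij => by
        rw [OrderIso.lt_iff_lt, Subtype.mk_lt_mk]
        exact (S.orderEmbOfFin rfl).strictMono hij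
    refine ⟨{θ | θ ∘ f ∈ B}, (eventually_iterUltra_comp f (A := fun θ => θ ∈ B)).2 hB, ?_⟩
    intro θ hθ
    apply hBA
    have : (θ ∘ T.orderEmbOfFin rfl) ∘ f = θ ∘ S.orderEmbOfFin rfl := by
      funext i
      refine congrArg θ ?_
      rw [← Finset.coe_orderIsoOfFin_apply]
      exact congrArg Subtype.val ((T.orderIsoOfFin rfl).apply_symm_apply _)
    simpa [← this] using hθ
  have hne : ∀ S, (N S).NeBot := fun S => Filter.NeBot.comap_of_surj (iterUltra S.card).neBot
    (S.orderEmbOfFin rfl).injective.surjective_comp_right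
  have hdir : Directed (· ≥ ·) N := fun S T => ⟨S ∪ T, hmono _ _ Finset.subset_union_left,
    hmono _ _ Finset.subset_union_right⟩
  have hN : (⨅ S, N S).NeBot := Filter.iInf_neBot_of_directed' hdir hne
  refine ⟨Ultrafilter.of (⨅ S, N S), ?_⟩
  have key : ∀ (s : ℕ) (e : Fin s ↪o L) (A : (Fin s → ℕ) → Prop),
      (∀ᶠ θ in (iterUltra s : Filter _), A θ) →
        ∀ᶠ θ in (Ultrafilter.of (⨅ S, N S) : Filter _), A (θ ∘ e) := by
    intro s e A hA
    refine ((Ultrafilter.of_le _).trans (iInf_le N (Finset.univ.map e.toEmbedding))) ?_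
    have hcard : (Finset.univ.map e.toEmbedding).card = s := by simp
    obtain ⟨S, hS⟩ : ∃ S, S = Finset.univ.map e.toEmbedding := ⟨_, rfl⟩
    have hmem : ∀ i, e i ∈ S := fun i => by simp [hS]
    rw [← hS] at hcard ⊢
    clear hS
    subst hcard
    refine ⟨{θ | A θ}, hA, ?_⟩
    have : S.orderEmbOfFin rfl = e := (Finset.orderEmbOfFin_unique' rfl hmem).symm
    rw [this]
    exact subset_rfl
  have key' : ∀ (s : ℕ) (e : Fin s ↪o L) (A : (Fin s → ℕ) → Prop),
      (∀ᶠ θ in (Ultrafilter.of (⨅ S, N S) : Filter _), A (θ ∘ e)) →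
        (∀ᶠ θ in (iterUltra s : Filter _), A θ) := by
    intro s e A hA
    by_contra h
    rw [← Ultrafilter.eventually_not] at h
    have := key s e _ h
    rw [Ultrafilter.eventually_not] at this
    exact this hA
  refine ⟨fun s e e' A h => key s e' A (key' s e A h), fun a b hab => ?_⟩
  let e : Fin 2 ↪o L := OrderEmbedding.ofStrictMono ![a, b] (by
    rw [Fin.strictMono_iff_lt_succ]
    intro i
    fin_cases i
    simpa using hab)
  refine key 2 e (fun θ => θ 0 < θ 1) ?_
  simp only [eventually_iterUltra_succ]
  refine Filter.Eventually.of_forall fun m => ?_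
  have : ∀ᶠ m' in (Filter.hyperfilter ℕ : Filter ℕ), m < m' := by
    refine Nat.hyperfilter_le_atTop ?_
    exact Filter.eventually_gt_atTop m
  filter_upwards [this] with m' hm'
  refine Filter.Eventually.of_forall fun θ => ?_
  exact hm'

end

section

/-- The map on indices induced by maps on each of the `d` coordinates. -/
def coordMap {d n : ℕ} {A B : Type*} (f : Fin d → A → B) (v : (Fin d → A) × Fin n) :
    (Fin d → B) × Fin n :=
  (fun l => f l (v.1 l), v.2)

theorem coordMap_comp {d n : ℕ} {A B C : Type*} (g : Fin d → B → C) (f : Fin d → A → B) :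
    (coordMap g ∘ coordMap f : (Fin d → A) × Fin n → _) = coordMap fun l => g l ∘ f l :=
  rfl

open MvPolynomial

/-- A bilinear expression vanishing on all pairs `u < v` of an interval vanishes on some pair
`v < u`. -/
theorem exists_gt_sum_mul_eq_zero {F ι : Type*} [Field F] (S : Finset ι) (A B : ℝ → ι → F)
    {lo hi : ℝ} (hlh : lo < hi)
    (h : ∀ u ∈ Set.Ioo lo hi, ∀ v ∈ Set.Ioo lo hi, u < v → ∑ i ∈ S, A u i * B v i = 0) :
    ∃ u ∈ Set.Ioo lo hi, ∃ v ∈ Set.Ioo lo hi, v < u ∧ ∑ i ∈ S, A u i * B v i = 0 := by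
  classical
  let A' : ℝ → S → F := fun u i => A u i
  obtain ⟨T, hT, hspan⟩ := (Submodule.fg_span_iff_fg_span_finset_subset (A' '' Set.Ioo lo hi)).1
    (IsNoetherian.noetherian (Submodule.span F (A' '' Set.Ioo lo hi)))
  obtain ⟨U, hU, hUT⟩ := Finset.subset_set_image_iff.1 hT
  obtain ⟨z, hz, hUz⟩ : ∃ z ∈ Set.Ioo lo hi, ∀ u ∈ U, u < z := by
    obtain ⟨z, hz1, hz2⟩ := exists_between (show (insert lo U).max' (by simp) < hi by
      rw [Finset.max'_lt_iff]
      intro y hy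
      rcases Finset.mem_insert.1 hy with rfl | hy
      · exact hlh
      · exact (hU hy).2)
    rw [Finset.max'_lt_iff] at hz1
    exact ⟨z, ⟨hz1 _ (Finset.mem_insert_self _ _), hz2⟩,
      fun u hu => hz1 _ (Finset.mem_insert_of_mem hu)⟩
  obtain ⟨w, hw1, hw2⟩ := exists_between hz.2
  have hw : w ∈ Set.Ioo lo hi := ⟨hz.1.trans hw1, hw2⟩
  refine ⟨w, hw, z, hz, hw1, ?_⟩
  let φ : (S → F) →ₗ[F] F := ∑ i : S, B z i • LinearMap.proj i
  have hφ : ∀ u, φ (A' u) = ∑ i ∈ S, A u i * B z i := by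
    intro u
    rw [← Finset.sum_coe_sort]
    simp [φ, A', mul_comm]
  have hle : Submodule.span F (T : Set (S → F)) ≤ LinearMap.ker φ := by
    rw [Submodule.span_le]
    intro a ha
    rw [← hUT, Finset.coe_image] at ha
    obtain ⟨u, hu, rfl⟩ := ha
    simp only [SetLike.mem_coe, LinearMap.mem_ker]
    rw [hφ]
    exact h u (hU hu) z hz (hUz u hu)
  rw [← hφ]
  exact LinearMap.mem_ker.1 (hle (hspan ▸ Submodule.subset_span ⟨w, hw, rfl⟩))

section

variable {d n : ℕ} {κ F : Type*} [CommRing κ] [Field F] [Algebra κ F]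

/-- Vanishing of polynomials on the array `x` is the same at all increasing index tuples. -/
def OrderIndiscernible (κ : Type*) [CommRing κ] [Algebra κ F]
    (x : (Fin d → ℝ) × Fin n → F) : Prop :=
  ∀ (s : ℕ) (m m' : Fin d → Fin s → ℝ), (∀ l, StrictMono (m l)) → (∀ l, StrictMono (m' l)) →
    ∀ Φ : MvPolynomial ((Fin d → Fin s) × Fin n) κ,
      aeval (x ∘ coordMap m) Φ = 0 → aeval (x ∘ coordMap m') Φ = 0

theorem OrderIndiscernible.swap_iff {x : (Fin d → ℝ) × Fin n → F} (hx : OrderIndiscernible κ x)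
    {s : ℕ} {m : Fin d → Fin (s + 1) → ℝ} (hm : ∀ l, StrictMono (m l)) (l₀ : Fin d) (i : Fin s)
    (Φ : MvPolynomial ((Fin d → Fin (s + 1)) × Fin n) κ) :
    aeval (x ∘ coordMap m) Φ = 0 ↔ aeval (x ∘ coordMap fun l =>
      m l ∘ (Pi.mulSingle l₀ (Equiv.swap i.castSucc i.succ) : Fin d → Equiv.Perm _) l) Φ = 0 := by
  classical
  let r : ℝ → ℝ → Fin d → Fin (s + 1) → ℝ := fun u v =>
    Function.update m l₀ (Function.update (Function.update (m l₀) i.castSucc u) i.succ v)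
  have hne : i.castSucc ≠ i.succ := (Fin.castSucc_lt_succ).ne
  set lo := m l₀ i.castSucc with hlo
  set hi := m l₀ i.succ with hhi
  have hlh : lo < hi := hm l₀ (Fin.castSucc_lt_succ)
  have hr : ∀ u ∈ Set.Ioo lo hi, ∀ v ∈ Set.Ioo lo hi, u < v → ∀ l, StrictMono (r u v l) := by
    intro u hu v hv huv l
    by_cases hl : l = l₀
    · subst hl
      simp only [r, Function.update_self]
      intro a b hab
      rcases eq_or_ne a i.succ with rfl | ha1
      · have hb1 : b ≠ i.succ := hab.ne'
        have hb2 : b ≠ i.castSucc := ((Fin.castSucc_lt_succ).trans hab).ne'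
        simp only [Function.update_self, Function.update_of_ne hb1, Function.update_of_ne hb2]
        exact hv.2.trans (hm l hab)
      · rcases eq_or_ne b i.succ with rfl | hb1
        · rcases eq_or_ne a i.castSucc with rfl | ha2
          · simpa [hne] using huv
          · have : a < i.castSucc := lt_of_le_of_ne (Fin.le_castSucc_iff.2 hab) ha2
            simp only [Function.update_self, Function.update_of_ne ha1, Function.update_of_ne ha2]
            exact (hm l this).trans hv.1
        · rcases eq_or_ne a i.castSucc with rfl | ha2
          · have hb2 : b ≠ i.castSucc := hab.ne'
            have : i.succ < b := lt_of_le_of_ne (Fin.castSucc_lt_iff_succ_le.1 hab) hb1.symm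
            simp only [Function.update_self, Function.update_of_ne hb1, Function.update_of_ne hb2,
              Function.update_of_ne hne]
            exact hu.2.trans (hm l this)
          · rcases eq_or_ne b i.castSucc with rfl | hb2
            · simp only [Function.update_self, Function.update_of_ne ha1,
                Function.update_of_ne ha2, Function.update_of_ne hb1]
              exact (hm l hab).trans hu.1
            · simp only [Function.update_of_ne ha1, Function.update_of_ne ha2,
                Function.update_of_ne hb1, Function.update_of_ne hb2]
              exact hm l hab
    · simp only [r, Function.update_of_ne hl]
      exact hm l
  have hrswap : ∀ u v, r u v = fun l => r v u l ∘
      (Pi.mulSingle l₀ (Equiv.swap i.castSucc i.succ) : Fin d → Equiv.Perm _) l := by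
    intro u v
    funext l j
    by_cases hl : l = l₀
    · subst hl
      simp only [r, Function.update_self, Pi.mulSingle_eq_same, Function.comp_apply]
      rcases eq_or_ne j i.succ with rfl | h1
      · simp [hne]
      · rcases eq_or_ne j i.castSucc with rfl | h2
        · simp [hne]
        · simp [h1, h2, Equiv.swap_apply_of_ne_of_ne]
    · simp [r, hl]
  let a : ℝ → ℝ → (Fin d → Fin (s + 1)) × Fin n → F := fun u v => x ∘ coordMap (r u v)
  let A : ℝ → _ → F := fun u e => algebraMap κ F (Φ.coeff e) *
    ∏ w with w.1 l₀ ≠ i.succ, a u hi w ^ e w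
  let B : ℝ → _ → F := fun v (e : (Fin d → Fin (s + 1)) × Fin n →₀ ℕ) =>
    ∏ w with ¬ w.1 l₀ ≠ i.succ, a lo v w ^ e w
  have hsep : ∀ u v, aeval (x ∘ coordMap (r u v)) Φ = ∑ e ∈ Φ.support, A u e * B v e := by
    intro u v
    rw [aeval_def, eval₂_eq']
    refine Finset.sum_congr rfl fun e _ => ?_
    rw [← Finset.prod_filter_mul_prod_filter_not Finset.univ (fun w => w.1 l₀ ≠ i.succ),
      ← mul_assoc]
    congr 1
    · congr 1
      refine Finset.prod_congr rfl fun w hw => ?_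
      congr 1
      simp only [a, Function.comp_apply]
      congr 1
      refine Prod.ext (funext fun l => ?_) rfl
      have hw := (Finset.mem_filter.1 hw).2
      by_cases hl : l = l₀
      · subst hl
        simp [coordMap, r, Function.update_of_ne hw]
      · simp [coordMap, r, hl]
    · refine Finset.prod_congr rfl fun w hw => ?_
      congr 1
      simp only [a, Function.comp_apply]
      congr 1
      refine Prod.ext (funext fun l => ?_) rfl
      have hw := not_not.1 (Finset.mem_filter.1 hw).2
      by_cases hl : l = l₀
      · subst hl
        simp [coordMap, r, hw]
      · simp [coordMap, r, hl]
  have hlt : ∀ u ∈ Set.Ioo lo hi, ∀ v ∈ Set.Ioo lo hi, u < v →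
      (aeval (x ∘ coordMap m) Φ = 0 ↔ ∑ e ∈ Φ.support, A u e * B v e = 0) := by
    intro u hu v hv huv
    rw [← hsep]
    exact ⟨hx _ _ _ hm (hr u hu v hv huv) Φ, hx _ _ _ (hr u hu v hv huv) hm Φ⟩
  have hgt : ∀ u ∈ Set.Ioo lo hi, ∀ v ∈ Set.Ioo lo hi, v < u →
      (aeval (x ∘ coordMap fun l => m l ∘
        (Pi.mulSingle l₀ (Equiv.swap i.castSucc i.succ) : Fin d → Equiv.Perm _) l) Φ = 0 ↔
        ∑ e ∈ Φ.support, A u e * B v e = 0) := by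
    intro u hu v hv huv
    rw [← hsep, hrswap u v, ← coordMap_comp, ← coordMap_comp, ← Function.comp_assoc,
      ← Function.comp_assoc, ← aeval_rename (g := x ∘ coordMap m),
      ← aeval_rename (g := x ∘ coordMap (r v u))]
    exact ⟨hx _ _ _ hm (hr v hv u hu huv) _, hx _ _ _ (hr v hv u hu huv) hm _⟩
  constructor
  · intro h
    obtain ⟨u, hu, v, hv, huv, h0⟩ := exists_gt_sum_mul_eq_zero Φ.support A B hlh
      fun u hu v hv huv => (hlt u hu v hv huv).1 h
    exact (hgt u hu v hv huv).2 h0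
  · intro h
    obtain ⟨u, hu, v, hv, huv, h0⟩ := exists_gt_sum_mul_eq_zero Φ.support B A hlh
      fun u hu v hv huv => by
        simp only [mul_comm (B u _)]
        exact (hgt v hv u hu huv).1 h
    simp only [mul_comm (B u _)] at h0
    exact (hlt v hv u hu huv).2 h0

theorem OrderIndiscernible.perm_iff {x : (Fin d → ℝ) × Fin n → F} (hx : OrderIndiscernible κ x)
    {s : ℕ} {m : Fin d → Fin s → ℝ} (hm : ∀ l, StrictMono (m l))
    (τ : Fin d → Equiv.Perm (Fin s)) (Φ : MvPolynomial ((Fin d → Fin s) × Fin n) κ) :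
    aeval (x ∘ coordMap m) Φ = 0 ↔ aeval (x ∘ coordMap fun l => m l ∘ τ l) Φ = 0 := by
  let G : Submonoid (Fin d → Equiv.Perm (Fin s)) :=
    { carrier := {τ | ∀ Φ : MvPolynomial ((Fin d → Fin s) × Fin n) κ,
        aeval (x ∘ coordMap m) Φ = 0 ↔ aeval (x ∘ coordMap fun l => m l ∘ τ l) Φ = 0}
      one_mem' := fun Φ => Iff.rfl
      mul_mem' := by
        intro τ σ hτ hσ Φ
        have h1 := hτ (rename (coordMap fun l => σ l) Φ)
        rw [aeval_rename, aeval_rename] at h1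
        exact (hσ Φ).trans h1 }
  refine (?_ : τ ∈ G) Φ
  refine Submonoid.pi_mem_of_mulSingle_mem τ fun l => ?_
  rcases s with _ | s
  · rw [Subsingleton.elim (τ l) 1, Pi.mulSingle_one]
    exact G.one_mem
  have h2 : Submonoid.closure (Set.range fun i : Fin s => Equiv.swap i.castSucc i.succ) ≤
      G.comap (MonoidHom.mulSingle (fun _ => Equiv.Perm (Fin (s + 1))) l) := by
    rw [Submonoid.closure_le]
    rintro _ ⟨i, rfl⟩ Φ
    exact hx.swap_iff hm l i Φ
  rw [Equiv.Perm.mclosure_swap_castSucc_succ] at h2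
  exact h2 (Submonoid.mem_top (τ l))

theorem exists_strictMono_comp_perm {s : ℕ} {w : Fin s → ℝ} (hw : Function.Injective w) :
    ∃ (m : Fin s → ℝ) (τ : Equiv.Perm (Fin s)), StrictMono m ∧ w = m ∘ τ :=
  ⟨w ∘ Tuple.sort w, (Tuple.sort w)⁻¹, (Tuple.monotone_sort w).strictMono_of_injective
    (hw.comp (Tuple.sort w).injective), by funext i; simp⟩

theorem OrderIndiscernible.injective_iff {x : (Fin d → ℝ) × Fin n → F}
    (hx : OrderIndiscernible κ x) {s : ℕ} {w w' : Fin d → Fin s → ℝ}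
    (hw : ∀ l, Function.Injective (w l)) (hw' : ∀ l, Function.Injective (w' l))
    (Φ : MvPolynomial ((Fin d → Fin s) × Fin n) κ) :
    aeval (x ∘ coordMap w) Φ = 0 ↔ aeval (x ∘ coordMap w') Φ = 0 := by
  choose m τ hm h using fun l => exists_strictMono_comp_perm (hw l)
  choose m' τ' hm' h' using fun l => exists_strictMono_comp_perm (hw' l)
  obtain rfl : w = _ := funext h
  obtain rfl : w' = _ := funext h'
  rw [← hx.perm_iff hm, ← hx.perm_iff hm']
  exact ⟨hx _ _ _ hm hm' Φ, hx _ _ _ hm' hm Φ⟩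

/-- Vanishing of polynomials on the array `x` is invariant under injective changes of indices
in each coordinate. -/
def Indiscernible (κ : Type*) [CommRing κ] [Algebra κ F] {J : Type*}
    (x : (Fin d → J) × Fin n → F) : Prop :=
  ∀ (C : Finset J) (w : Fin d → J → J), (∀ l, Set.InjOn (w l) C) →
    ∀ Φ : MvPolynomial ((Fin d → J) × Fin n) κ, (∀ v ∈ Φ.vars, ∀ l, v.1 l ∈ C) →
      (aeval x Φ = 0 ↔ aeval (x ∘ coordMap w) Φ = 0)

theorem OrderIndiscernible.indiscernible {x : (Fin d → ℝ) × Fin n → F}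
    (hx : OrderIndiscernible κ x) {J : Type*} {ι : J → ℝ} (hι : Function.Injective ι) :
    Indiscernible κ (x ∘ coordMap fun _ => ι) := by
  intro C w hw Φ hΦ
  let e := C.equivFin.symm
  have he : Function.Injective fun i => (e i : J) :=
    Subtype.val_injective.comp e.injective
  obtain ⟨Φ₀, rfl⟩ := exists_rename_eq_of_vars_subset_range Φ
    (coordMap (n := n) fun (_ : Fin d) i => (e i : J)) (by
      rintro ⟨a, c⟩ ⟨b, c'⟩ h
      simp only [coordMap, Prod.mk.injEq] at h
      exact Prod.ext (funext fun l => he (congrFun h.1 l)) h.2) (by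
      rintro v hv
      refine ⟨(fun l => e.symm ⟨v.1 l, hΦ v hv l⟩, v.2), ?_⟩
      simp [coordMap])
  rw [aeval_rename, aeval_rename]
  simp only [Function.comp_assoc, coordMap_comp]
  refine hx.injective_iff (fun l => hι.comp he) (fun l i j hij => ?_) Φ₀
  exact he (hw l (e i).2 (e j).2 (hι hij))

end

end

section

open MvPolynomial

open Classical in
/-- The coordinates of the points `g M`, `M = θ ⊤`, at the indices given by `θ`, with junk value
`0` for indices outside `Fin M`. -/
noncomputable def sampledArray {d n : ℕ} {J : Type*} (g : ∀ M : ℕ, (Fin d → Fin M) → Fin n → ℝ)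
    (θ : WithTop (Fin d ×ₗ J) → ℕ) (v : (Fin d → J) × Fin n) : ℝ :=
  if h : ∀ l, θ (toLex (l, v.1 l) : Fin d ×ₗ J) < θ ⊤ then g (θ ⊤) (fun l => ⟨_, h l⟩) v.2 else 0

/-- The map on `WithTop (Fin d ×ₗ A)` induced by maps on each block. -/
def blockMap {d : ℕ} {A B : Type*} (m : Fin d → A → B) :
    WithTop (Fin d ×ₗ A) → WithTop (Fin d ×ₗ B) :=
  WithTop.map fun a => toLex ((ofLex a).1, m (ofLex a).1 (ofLex a).2)

theorem strictMono_blockMap {d : ℕ} {A B : Type*} [LinearOrder A] [LinearOrder B]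
    {m : Fin d → A → B} (hm : ∀ l, StrictMono (m l)) : StrictMono (blockMap m) := by
  refine StrictMono.withTop_map fun a b hab => ?_
  rw [Prod.Lex.lt_iff] at hab ⊢
  rcases hab with h | ⟨h1, h2⟩
  · exact Or.inl h
  · refine Or.inr ⟨h1, ?_⟩
    simp only [ofLex_toLex]
    rw [← h1]
    exact hm _ h2

theorem sampledArray_comp_coordMap {d n : ℕ} {A B : Type*}
    (g : ∀ M : ℕ, (Fin d → Fin M) → Fin n → ℝ) (θ : WithTop (Fin d ×ₗ B) → ℕ)
    (m : Fin d → A → B) :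
    sampledArray g θ ∘ coordMap m = sampledArray g (θ ∘ blockMap m) :=
  rfl

theorem exists_orderIndiscernible_array {d n : ℕ} (κ : Subfield ℝ)
    (g : ∀ M : ℕ, (Fin d → Fin M) → Fin n → ℝ) :
    ∃ (F : Type) (_ : Field F) (_ : Algebra κ F) (x : (Fin d → ℝ) × Fin n → F),
      OrderIndiscernible κ x ∧
      ∀ (T : Finset (MvPolynomial ((Fin d → ℝ) × Fin n) κ)) (C : Finset ℝ),
        ∃ (y : (Fin d → ℝ) × Fin n → ℝ) (M : ℕ) (ρ : Fin d → ℝ → Fin M),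
          (∀ Φ ∈ T, aeval y Φ = 0 ↔ aeval x Φ = 0) ∧ (∀ l, Set.InjOn (ρ l) C) ∧
          ∀ r : Fin d → ℝ, (∀ l, r l ∈ C) → ∀ c, y (r, c) = g M (fun l => ρ l (r l)) c := by
  classical
  obtain ⟨W, hW, hlt⟩ := exists_indiscernible_ultrafilter (WithTop (Fin d ×ₗ ℝ))
  let F := Filter.Germ (W : Filter (WithTop (Fin d ×ₗ ℝ) → ℕ)) ℝ
  let : Field F := Filter.Germ.instField
  let : Algebra κ F := ((Filter.Germ.coeRingHom (W : Filter (WithTop (Fin d ×ₗ ℝ) → ℕ))).comp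
    ((Pi.constRingHom _ ℝ).comp κ.subtype)).toAlgebra
  let x : (Fin d → ℝ) × Fin n → F := fun v => ((fun θ => sampledArray g θ v :
    (WithTop (Fin d ×ₗ ℝ) → ℕ) → ℝ) : F)
  have hx : ∀ Φ : MvPolynomial ((Fin d → ℝ) × Fin n) κ,
      aeval x Φ = ((fun θ => aeval (sampledArray g θ) Φ : (WithTop (Fin d ×ₗ ℝ) → ℕ) → ℝ) : F) := by
    intro Φ
    induction Φ using MvPolynomial.induction_on with
    | C a => simp only [aeval_C]; rfl
    | add p q hp hq => simp only [map_add, hp, hq]; rfl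
    | mul_X p v hp => simp only [map_mul, hp, aeval_X]; rfl
  have hx0 : ∀ Φ : MvPolynomial ((Fin d → ℝ) × Fin n) κ, aeval x Φ = 0 ↔
      ∀ᶠ θ in (W : Filter (WithTop (Fin d ×ₗ ℝ) → ℕ)), aeval (sampledArray g θ) Φ = 0 := by
    intro Φ
    rw [hx]
    exact Filter.Germ.coe_eq
  refine ⟨F, inferInstance, inferInstance, x, ?_, ?_⟩
  · intro s m m' hm hm' Φ h
    rw [← aeval_rename, hx0] at h ⊢
    simp only [aeval_rename, sampledArray_comp_coordMap] at h ⊢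
    let o : Fin (Fintype.card (WithTop (Fin d ×ₗ Fin s))) ≃o WithTop (Fin d ×ₗ Fin s) :=
      (Fintype.orderIsoFinOfCardEq (WithTop (Fin d ×ₗ Fin s)) rfl)
    let e := OrderEmbedding.ofStrictMono (blockMap m ∘ o)
      ((strictMono_blockMap hm).comp o.strictMono)
    let e' := OrderEmbedding.ofStrictMono (blockMap m' ∘ o)
      ((strictMono_blockMap hm').comp o.strictMono)
    have := hW _ e e' (fun θ => aeval (sampledArray g (θ ∘ o.symm)) Φ = 0)
    have he : e ∘ o.symm = blockMap m := by
      funext j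
      simp [e]
    have he' : e' ∘ o.symm = blockMap m' := by
      funext j
      simp [e']
    simp only [Function.comp_assoc, he, he'] at this
    exact this h
  · intro T C
    have h1 : ∀ Φ ∈ T, ∀ᶠ θ in (W : Filter (WithTop (Fin d ×ₗ ℝ) → ℕ)),
        (aeval (sampledArray g θ) Φ = 0 ↔ aeval x Φ = 0) := by
      intro Φ _
      by_cases h : aeval x Φ = 0
      · filter_upwards [(hx0 Φ).1 h] with θ hθ
        simp [hθ, h]
      · have h' := h
        rw [hx0, ← Ultrafilter.eventually_not] at h'
        filter_upwards [h'] with θ hθ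
        simp [hθ, h]
    have h2 : ∀ l : Fin d, ∀ c ∈ insert 0 C, ∀ᶠ θ in (W : Filter (WithTop (Fin d ×ₗ ℝ) → ℕ)),
        θ (toLex (l, c) : Fin d ×ₗ ℝ) < θ ⊤ := fun l c _ => hlt _ _ (WithTop.coe_lt_top _)
    have h3 : ∀ l : Fin d, ∀ c ∈ C, ∀ c' ∈ C, ∀ᶠ θ in (W : Filter (WithTop (Fin d ×ₗ ℝ) → ℕ)),
        c < c' → θ (toLex (l, c) : Fin d ×ₗ ℝ) < θ (toLex (l, c') : Fin d ×ₗ ℝ) := by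
      intro l c _ c' _
      by_cases h : c < c'
      · simp only [h, true_implies]
        refine hlt _ _ (WithTop.coe_lt_coe.2 ?_)
        rw [Prod.Lex.toLex_lt_toLex]
        exact Or.inr ⟨rfl, h⟩
      · simp [h]
    have h1' := (Filter.eventually_all_finset T).2 h1
    have h2' := Filter.eventually_all.2 fun l => (Filter.eventually_all_finset _).2 (h2 l)
    have h3' := Filter.eventually_all.2 fun l => (Filter.eventually_all_finset _).2 fun c hc =>
      (Filter.eventually_all_finset _).2 (h3 l c hc)
    obtain ⟨θ, hθ1, hθ2, hθ3⟩ := (h1'.and (h2'.and h3')).exists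
    refine ⟨sampledArray g θ, θ ⊤, fun l c =>
      if h : θ (toLex (l, c) : Fin d ×ₗ ℝ) < θ ⊤ then ⟨_, h⟩
      else ⟨_, hθ2 l 0 (Finset.mem_insert_self _ _)⟩, hθ1, ?_, ?_⟩
    · intro l a ha b hb hab
      have ha' := hθ2 l a (Finset.mem_insert_of_mem ha)
      have hb' := hθ2 l b (Finset.mem_insert_of_mem hb)
      simp only [ha', hb', dite_true, Fin.mk.injEq] at hab
      by_contra hne
      rcases lt_or_gt_of_ne hne with h | h
      · exact (hθ3 l a ha b hb h).ne hab
      · exact (hθ3 l b hb a ha h).ne' hab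
    · intro r hr c
      have hr' : ∀ l, θ (toLex (l, r l) : Fin d ×ₗ ℝ) < θ ⊤ := fun l =>
        hθ2 l _ (Finset.mem_insert_of_mem (hr l))
      simp [sampledArray, hr']

end

section

open MvPolynomial Filter Topology

section

variable {σ κ R : Type*} [CommRing κ] [CommRing R] [Algebra κ R]

/-- Evaluation of a polynomial whose coefficients are polynomials in further variables. -/
noncomputable def peval (z : σ → R) (w : R) (Ψ : Polynomial (MvPolynomial σ κ)) : R :=
  Ψ.eval₂ (aeval z : MvPolynomial σ κ →ₐ[κ] R).toRingHom w

theorem peval_self (z : σ → R) (a : σ) (Ψ : Polynomial (MvPolynomial σ κ)) :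
    peval z (z a) Ψ = aeval z (Ψ.eval (X a)) := by
  rw [← Polynomial.eval₂_id, ← AlgHom.coe_toRingHom, Polynomial.hom_eval₂, peval]
  simp

theorem peval_congr {z z' : σ → R} {w : R} {Ψ : Polynomial (MvPolynomial σ κ)} {B : Set σ}
    (hB : ∀ i, Ψ.coeff i ∈ supported κ B) (h : ∀ b ∈ B, z b = z' b) :
    peval z w Ψ = peval z' w Ψ := by
  rw [peval, peval, Polynomial.eval₂_eq_sum, Polynomial.eval₂_eq_sum]
  refine Finset.sum_congr rfl fun i _ => ?_
  refine congrArg (· * w ^ _) ?_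
  exact eval₂Hom_congr' rfl (fun b hb _ => h b (mem_supported.1 (hB i) hb)) rfl

theorem peval_map_rename {τ : Type*} (z : τ → R) (w : R) (π : σ → τ)
    (Ψ : Polynomial (MvPolynomial σ κ)) :
    peval z w (Ψ.map (rename π : MvPolynomial σ κ →ₐ[κ] _).toRingHom) = peval (z ∘ π) w Ψ := by
  rw [peval, peval, Polynomial.eval₂_map]
  congr 1
  ext <;> simp

theorem peval_eq_zero_of_coeff {z : σ → R} {w : R} {Ψ : Polynomial (MvPolynomial σ κ)}
    (h : ∀ i, aeval z (Ψ.coeff i) = 0) : peval z w Ψ = 0 := by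
  rw [peval, Polynomial.eval₂_eq_sum]
  refine Finset.sum_eq_zero fun i _ => ?_
  have : (aeval z : MvPolynomial σ κ →ₐ[κ] R).toRingHom (Ψ.coeff i) = 0 := h i
  simp only [this, zero_mul]

end

theorem exists_delta_of_eventually_nhds_pi {σ : Type*} {z : σ → ℝ} {P : (σ → ℝ) → Prop}
    (h : ∀ᶠ u in 𝓝 z, P u) : ∃ δ > 0, ∀ u, (∀ b, |u b - z b| < δ) → P u := by
  rw [nhds_pi, Filter.Eventually, Filter.mem_pi'] at h
  obtain ⟨I, t, ht, hI⟩ := h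
  choose δ hδ hball using fun b => Metric.mem_nhds_iff.1 (ht b)
  have h1 : ∀ b ∈ I, ∀ᶠ e in 𝓝[>] (0 : ℝ), e < δ b := fun b _ =>
    eventually_nhdsWithin_of_eventually_nhds (gt_mem_nhds (hδ b))
  obtain ⟨e, he1, he2⟩ := (((Filter.eventually_all_finset I).2 h1).and
    self_mem_nhdsWithin).exists
  refine ⟨e, he2, fun u hu => hI fun b hb => hball b ?_⟩
  rw [Metric.mem_ball, Real.dist_eq]
  exact (hu b).trans (he1 b hb)

/-- A polynomial changes sign near a simple real root. -/
theorem Polynomial.exists_mul_neg_near_root {q : Polynomial ℝ} {a : ℝ} (h0 : q.eval a = 0)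
    (h1 : q.derivative.eval a ≠ 0) {η : ℝ} (hη : 0 < η) :
    ∃ t > 0, t < η ∧ q.eval (a - t) * q.eval (a + t) < 0 := by
  obtain ⟨r, rfl⟩ := Polynomial.dvd_iff_isRoot.2 h0
  have hr : r.eval a ≠ 0 := by simpa [Polynomial.derivative_mul] using h1
  have hc : Continuous fun t => r.eval (a - t) * r.eval (a + t) := by fun_prop
  have hpos : ∀ᶠ t in 𝓝[>] (0 : ℝ), 0 < r.eval (a - t) * r.eval (a + t) := by
    refine eventually_nhdsWithin_of_eventually_nhds (hc.tendsto 0 |>.eventually_const_lt ?_)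
    simpa using mul_self_pos.2 hr
  obtain ⟨t, ⟨ht1, ht2⟩, ht3⟩ := ((hpos.and self_mem_nhdsWithin).and
    (eventually_nhdsWithin_of_eventually_nhds (gt_mem_nhds hη))).exists
  refine ⟨t, ht2, ht3, ?_⟩
  have ht0 : 0 < t := ht2
  simp only [Polynomial.eval_mul, Polynomial.eval_sub, Polynomial.eval_X, Polynomial.eval_C]
  nlinarith [mul_pos (mul_pos ht0 ht0) ht1]

section

variable {σ κ : Type*} [CommRing κ] [Algebra κ ℝ]

theorem continuous_aeval_real (Φ : MvPolynomial σ κ) :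
    Continuous fun u : σ → ℝ => aeval u Φ := by
  simp_rw [aeval_def, ← eval_map]
  exact MvPolynomial.continuous_eval _

theorem continuous_peval (w : ℝ) (f : Polynomial (MvPolynomial σ κ)) :
    Continuous fun u : σ → ℝ => peval u w f := by
  simp_rw [peval, Polynomial.eval₂_eq_sum, Polynomial.sum]
  exact continuous_finsetSum _ fun i _ => (continuous_aeval_real (f.coeff i)).mul continuous_const

theorem exists_root_near {z : σ → ℝ} {a : σ} {f : Polynomial (MvPolynomial σ κ)} {c : MvPolynomial σ κ}
    (h0 : peval z (z a) f = 0) (h1 : peval z (z a) f.derivative ≠ 0) (hc : aeval z c ≠ 0)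
    {η : ℝ} (hη : 0 < η) :
    ∃ δ > 0, ∀ u : σ → ℝ, (∀ b, |u b - z b| < δ) →
      aeval u c ≠ 0 ∧ ∃ w, |w - z a| < η ∧ peval u w f = 0 := by
  have hq : ∀ (u : σ → ℝ) w, (f.map (aeval u : MvPolynomial σ κ →ₐ[κ] ℝ).toRingHom).eval w =
      peval u w f := fun u w => by rw [Polynomial.eval_map, peval]
  obtain ⟨t, ht, htη, hneg⟩ := Polynomial.exists_mul_neg_near_root
    (q := f.map (aeval z : MvPolynomial σ κ →ₐ[κ] ℝ).toRingHom) (a := z a)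
    (by rw [hq, h0]) (by rwa [Polynomial.derivative_map, Polynomial.eval_map]) hη
  simp only [hq] at hneg
  have e1 : ∀ᶠ u in 𝓝 z, aeval u c ≠ 0 :=
    (continuous_aeval_real c).tendsto z |>.eventually_ne hc
  have e2 : ∀ᶠ u in 𝓝 z, peval u (z a - t) f * peval u (z a + t) f < 0 :=
    ((continuous_peval _ f).mul (continuous_peval _ f)).tendsto z |>.eventually_lt_const hneg
  obtain ⟨δ, hδ, h⟩ := exists_delta_of_eventually_nhds_pi (e1.and e2)
  refine ⟨δ, hδ, fun u hu => ⟨(h u hu).1, ?_⟩⟩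
  have hsgn := (h u hu).2
  have hcont : Continuous fun w => peval u w f := by
    simp_rw [← hq]
    fun_prop
  have hle : z a - t ≤ z a + t := by linarith
  obtain ⟨w, hw, hw0⟩ : ∃ w ∈ Set.Icc (z a - t) (z a + t), peval u w f = 0 := by
    rcases mul_neg_iff.1 hsgn with ⟨h2, h3⟩ | ⟨h2, h3⟩
    · exact intermediate_value_Icc' hle hcont.continuousOn ⟨h3.le, h2.le⟩
    · exact intermediate_value_Icc hle hcont.continuousOn ⟨h2.le, h3.le⟩
  exact ⟨w, abs_lt.2 ⟨by linarith [hw.1], by linarith [hw.2]⟩, hw0⟩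

end

/-- Tolerances for a finite set of conditions, each of which concerns a point and tolerates
small perturbations at the points of smaller key. -/
theorem exists_tolerances {σ Λ : Type*} [LinearOrder Λ] (key : σ → Λ) (z : σ → ℝ)
    (G : σ → ℝ → (σ → ℝ) → Prop) (Y : Finset σ)
    (hG : ∀ a ∈ Y, ∀ η > 0, ∃ δ > 0, ∀ u : σ → ℝ, (∀ b, |u b - z b| < δ) → G a η u) :
    ∃ ε : σ → ℝ, (∀ b, 0 < ε b) ∧ ∀ a ∈ Y, ∀ u : σ → ℝ, (∀ b, ¬ key b < key a → u b = z b) →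
      (∀ b, |u b - z b| < ε b) → G a (ε a) u := by
  classical
  induction Y using Finset.induction_on_min_value key with
  | empty => exact ⟨fun _ => 1, fun _ => one_pos, by simp⟩
  | insert a Y _ hmin ih =>
    obtain ⟨ε, hε, h⟩ := ih fun b hb => hG b (Finset.mem_insert_of_mem hb)
    obtain ⟨δ, hδ, hδG⟩ := hG a (Finset.mem_insert_self _ _) (ε a) (hε a)
    refine ⟨fun b => if key b < key a then min (ε b) δ else ε b, fun b => ?_, ?_⟩
    · dsimp only
      split_ifs
      exacts [lt_min (hε b) hδ, hε b]
    · intro a' ha' u hu hu'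
      rcases Finset.mem_insert.1 ha' with rfl | ha'
      · simp only [lt_irrefl, if_false]
        refine hδG u fun b => ?_
        by_cases hb : key b < key a'
        · have := hu' b
          simp only [if_pos hb] at this
          exact this.trans_le (min_le_right _ _)
        · rw [hu b hb]
          simpa using hδ
      · simp only [(hmin a' ha').not_gt, if_false]
        refine h a' ha' u hu fun b => (hu' b).trans_le ?_
        dsimp only
        split_ifs
        exacts [min_le_left _ _, le_rfl]

end

/-- Any family of at most continuum many real numbers can be approximated by a family which is
algebraically independent over a given countable subfield. -/
theorem exists_algebraicIndependent_near (κ : Subfield ℝ) [Countable κ] {V : Type} (hV : #V ≤ 𝔠)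
    (z ε : V → ℝ) (hε : ∀ v, 0 < ε v) :
    ∃ t : V → ℝ, AlgebraicIndependent κ t ∧ ∀ v, |t v - z v| < ε v := by
  obtain ⟨ι, b, hb⟩ := exists_isTranscendenceBasis' κ ℝ
  have hι : #ι = 𝔠 := by
    refine le_antisymm (Cardinal.mk_real ▸ mk_le_of_injective hb.1.injective) ?_
    by_contra hlt
    have := hb.isAlgebraic
    have h1 : #ℝ ≤ max #(Algebra.adjoin κ (Set.range b)) ℵ₀ :=
      Algebra.IsAlgebraic.cardinalMk_le_max _ _
    have h2 : #(Algebra.adjoin κ (Set.range b)) = #(MvPolynomial ι κ) :=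
      (mk_congr hb.1.aevalEquiv.toEquiv).symm
    have h3 : #(MvPolynomial ι κ) ≤ max (max #κ #ι) ℵ₀ := MvPolynomial.cardinalMk_le_max
    rw [h2, mk_real] at h1
    refine (h1.trans (max_le_max h3 le_rfl)).not_gt ?_
    simp only [max_lt_iff]
    exact ⟨⟨⟨(mk_le_aleph0 (α := κ)).trans_lt aleph0_lt_continuum, not_le.1 hlt⟩,
      aleph0_lt_continuum⟩, aleph0_lt_continuum⟩
  obtain ⟨j⟩ : Nonempty (V ↪ ι) := by rw [← Cardinal.le_def, hι]; exact hV
  have h1 : ∀ v, ∃ q r : ℚ, q ≠ 0 ∧ |(q * b (j v) + r : ℝ) - z v| < ε v := by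
    intro v
    obtain ⟨r, hr1, hr2⟩ := exists_rat_btwn (show z v - ε v / 2 < z v by linarith [hε v])
    have hb0 : 0 < |b (j v)| + 1 := by positivity
    obtain ⟨q, hq1, hq2⟩ := exists_rat_btwn (show 0 < ε v / 2 / (|b (j v)| + 1) by
      have := hε v; positivity)
    refine ⟨q, r, by rintro rfl; simp at hq1, ?_⟩
    have h2 : |(q : ℝ) * b (j v)| < ε v / 2 := by
      rw [abs_mul, abs_of_pos hq1]
      rw [lt_div_iff₀ hb0] at hq2
      nlinarith
    rw [abs_lt] at h2 ⊢
    constructor <;> linarith [h2.1, h2.2]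
  choose q r hq hqr using h1
  refine ⟨fun v => q v * b (j v) + r v, ?_, hqr⟩
  have hj : AlgebraicIndependent κ (b ∘ j) := hb.1.comp j j.injective
  have hdeg : ∀ v, (Polynomial.C (q v : κ) * Polynomial.X + Polynomial.C (r v : κ)).natDegree = 1 :=
    fun v => Polynomial.natDegree_linear (by exact_mod_cast hq v)
  have := hj.polynomial_aeval_of_transcendental (f := fun v =>
    Polynomial.C (q v : κ) * Polynomial.X + Polynomial.C (r v : κ)) fun v =>
      Polynomial.transcendental _ (by simp [hdeg]) (by
        rw [Polynomial.leadingCoeff, hdeg]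
        simpa using hq v)
  convert this using 2 with v
  simp

section

open MvPolynomial

section

variable {σ κ F : Type*} [CommRing κ] [Field F] [Algebra κ F]

/-- `z a` satisfies no nontrivial polynomial relation over the coordinates of `z` in `B`. -/
def IsFreeOver (κ : Type*) [CommRing κ] [Algebra κ F] (z : σ → F) (B : Set σ) (a : σ) : Prop :=
  ∀ Ψ : Polynomial (MvPolynomial σ κ), (∀ i, Ψ.coeff i ∈ supported κ B) →
    peval z (z a) Ψ = 0 → ∀ i, aeval z (Ψ.coeff i) = 0

/-- `f` is a nontrivial polynomial relation, of least possible degree `D`, satisfied by `z a` over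
the coordinates of `z` in `B`. -/
structure IsMinRel (z : σ → F) (B : Set σ) (a : σ) (f : Polynomial (MvPolynomial σ κ)) (D : ℕ) :
    Prop where
  coeff_mem : ∀ i, f.coeff i ∈ supported κ B
  coeff_eq_zero : ∀ i, D < i → f.coeff i = 0
  root : peval z (z a) f = 0
  lead : aeval z (f.coeff D) ≠ 0
  deriv : peval z (z a) f.derivative ≠ 0
  min : ∀ Ψ : Polynomial (MvPolynomial σ κ), (∀ i, Ψ.coeff i ∈ supported κ B) →
    (∀ i, D ≤ i → Ψ.coeff i = 0) → peval z (z a) Ψ = 0 → ∀ i, aeval z (Ψ.coeff i) = 0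

theorem exists_isMinRel [CharZero F] {z : σ → F} {B : Set σ} {a : σ} (h : ¬ IsFreeOver κ z B a) :
    ∃ (f : Polynomial (MvPolynomial σ κ)) (D : ℕ), IsMinRel z B a f D := by
  classical
  let P : ℕ → Prop := fun N => ∃ Ψ : Polynomial (MvPolynomial σ κ),
    (∀ i, Ψ.coeff i ∈ supported κ B) ∧ (∀ i, N < i → Ψ.coeff i = 0) ∧ peval z (z a) Ψ = 0 ∧
      ∃ i, aeval z (Ψ.coeff i) ≠ 0
  have hP : ∃ N, P N := by
    simp only [IsFreeOver, not_forall] at h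
    obtain ⟨Ψ, h1, h2, i, h3⟩ := h
    exact ⟨Ψ.natDegree, Ψ, h1, fun i hi => Polynomial.coeff_eq_zero_of_natDegree_lt hi, h2, i, h3⟩
  obtain ⟨f, h1, h2, h3, i₀, h4⟩ := Nat.find_spec hP
  set D := Nat.find hP with hD
  have hmin : ∀ Ψ : Polynomial (MvPolynomial σ κ), (∀ i, Ψ.coeff i ∈ supported κ B) →
      (∀ i, D ≤ i → Ψ.coeff i = 0) → peval z (z a) Ψ = 0 → ∀ i, aeval z (Ψ.coeff i) = 0 := by
    intro Ψ hΨ1 hΨ2 hΨ3 i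
    by_contra hi
    have hD0 : D ≠ 0 := by
      rintro h0
      exact hi (by rw [hΨ2 i (h0 ▸ Nat.zero_le i), map_zero])
    refine Nat.find_min hP (m := D - 1) (by omega) ⟨Ψ, hΨ1, fun i hi => hΨ2 i (by omega), hΨ3, i, hi⟩
  have hlead : aeval z (f.coeff D) ≠ 0 := by
    intro h0
    have h5 := hmin (f.erase D) (fun i => by
      rw [Polynomial.coeff_erase]
      split_ifs
      exacts [Subalgebra.zero_mem _, h1 i]) (fun i hi => by
      rw [Polynomial.coeff_erase]
      split_ifs with hiD
      exacts [rfl, h2 i (by omega)]) (by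
      have h6 := h3
      rw [← Polynomial.monomial_add_erase f D, peval, Polynomial.eval₂_add,
        Polynomial.eval₂_monomial] at h6
      have : (aeval z : MvPolynomial σ κ →ₐ[κ] F).toRingHom (f.coeff D) = 0 := h0
      rw [this, zero_mul, zero_add] at h6
      exact h6) i₀
    rw [Polynomial.coeff_erase] at h5
    split_ifs at h5 with h7
    · exact h4 (h7 ▸ h0)
    · exact h4 h5
  refine ⟨f, D, h1, h2, h3, hlead, fun h0 => ?_, hmin⟩
  have h5 := hmin f.derivative (fun i => by
    rw [Polynomial.coeff_derivative]
    exact mul_mem (h1 _) (by exact_mod_cast natCast_mem (supported κ B) (i + 1))) (fun i hi => by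
    rw [Polynomial.coeff_derivative, h2 _ (by omega), zero_mul]) h0 (D - 1)
  rcases Nat.eq_zero_or_pos D with hD0 | hD0
  · have hfC : f = Polynomial.C (f.coeff 0) := by
      ext1 i
      rw [Polynomial.coeff_C]
      split_ifs with hi
      · rw [hi]
      · exact h2 i (by omega)
    rw [hfC, peval, Polynomial.eval₂_C] at h3
    rw [hD0] at hlead
    exact hlead h3
  · rw [Polynomial.coeff_derivative, Nat.sub_add_cancel hD0, map_mul] at h5
    refine (mul_ne_zero hlead ?_) h5
    have : (((D - 1 : ℕ) : MvPolynomial σ κ) + 1) = (D : MvPolynomial σ κ) := by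
      norm_cast
      congr 1
      omega
    rw [this, map_natCast]
    exact_mod_cast hD0.ne'

theorem exists_eval_X_eq {Φ : MvPolynomial σ κ} {v : σ} {s : Set σ}
    (hΦ : Φ ∈ supported κ (insert v s)) : ∃ Ψ : Polynomial (MvPolynomial σ κ),
      (∀ i, Ψ.coeff i ∈ supported κ s) ∧ Ψ.eval (X v) = Φ := by
  rw [supported_eq_adjoin_X] at hΦ
  induction hΦ using Algebra.adjoin_induction with
  | mem y hy =>
    obtain ⟨w, hw, rfl⟩ := hy
    rcases hw with rfl | hw
    · refine ⟨Polynomial.X, fun i => ?_, by simp⟩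
      rw [Polynomial.coeff_X]
      split_ifs
      exacts [one_mem _, zero_mem _]
    · refine ⟨Polynomial.C (X w), fun i => ?_, by simp⟩
      rw [Polynomial.coeff_C]
      split_ifs
      exacts [by rw [supported_eq_adjoin_X]; exact Algebra.subset_adjoin ⟨w, hw, rfl⟩, zero_mem _]
  | algebraMap c =>
    refine ⟨Polynomial.C (C c), fun i => ?_, by simp [algebraMap_eq]⟩
    rw [Polynomial.coeff_C]
    split_ifs
    exacts [(supported κ s).algebraMap_mem c, zero_mem _]
  | add p q _ _ hp hq =>
    obtain ⟨P, hP, rfl⟩ := hp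
    obtain ⟨Q, hQ, rfl⟩ := hq
    exact ⟨P + Q, fun i => by rw [Polynomial.coeff_add]; exact add_mem (hP i) (hQ i), by simp⟩
  | mul p q _ _ hp hq =>
    obtain ⟨P, hP, rfl⟩ := hp
    obtain ⟨Q, hQ, rfl⟩ := hq
    refine ⟨P * Q, fun i => ?_, by simp⟩
    rw [Polynomial.coeff_mul]
    exact sum_mem fun j _ => mul_mem (hP _) (hQ _)

theorem aeval_mem_of_mem_supported {A : Type*} [CommRing A] [Algebra κ A] {z : σ → A}
    {B : Set σ} {K : Subring A} (hκ : ∀ c : κ, algebraMap κ A c ∈ K) (hB : ∀ b ∈ B, z b ∈ K)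
    {Φ : MvPolynomial σ κ} (hΦ : Φ ∈ supported κ B) : aeval z Φ ∈ K := by
  rw [supported_eq_adjoin_X] at hΦ
  induction hΦ using Algebra.adjoin_induction with
  | mem y hy =>
    obtain ⟨w, hw, rfl⟩ := hy
    simpa using hB w hw
  | algebraMap c => simpa [algebraMap_eq] using hκ c
  | add p q _ _ hp hq => simpa using add_mem hp hq
  | mul p q _ _ hp hq => simpa using mul_mem hp hq

end

/-- A finite set is contained in a finite set closed under a well-founded finite dependency. -/
theorem exists_finset_closed {V Λ : Type*} [LinearOrder Λ] [WellFoundedLT Λ] (k : V → Λ)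
    (S : Set V) (E : V → Finset V) (hE : ∀ v ∈ S, ∀ e ∈ E v, e ∈ S ∧ k e < k v) (W : Finset V)
    (hW : ↑W ⊆ S) : ∃ T : Finset V, W ⊆ T ∧ ↑T ⊆ S ∧ ∀ v ∈ T, E v ⊆ T := by
  classical
  have h1 : ∀ v ∈ S, ∃ T : Finset V, v ∈ T ∧ ↑T ⊆ S ∧ ∀ v ∈ T, E v ⊆ T := by
    intro v
    induction v using (InvImage.wf k (wellFounded_lt (α := Λ))).induction with
    | _ v ih =>
      intro hv
      have h2 : ∀ e : E v, ∃ T : Finset V, (e : V) ∈ T ∧ ↑T ⊆ S ∧ ∀ v ∈ T, E v ⊆ T := fun e =>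
        ih e (hE v hv e e.2).2 (hE v hv e e.2).1
      choose T hT1 hT2 hT3 using h2
      refine ⟨insert v (Finset.univ.biUnion T), Finset.mem_insert_self _ _, ?_, ?_⟩
      · intro w hw
        simp only [Finset.coe_insert, Finset.coe_biUnion, Set.mem_insert_iff, Set.mem_iUnion] at hw
        rcases hw with rfl | ⟨e, _, he⟩
        exacts [hv, hT2 e he]
      · intro w hw u hu
        rcases Finset.mem_insert.1 hw with rfl | hw
        · exact Finset.mem_insert_of_mem (Finset.mem_biUnion.2 ⟨⟨u, hu⟩, Finset.mem_univ _, hT1 _⟩)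
        · obtain ⟨e, -, he⟩ := Finset.mem_biUnion.1 hw
          exact Finset.mem_insert_of_mem
            (Finset.mem_biUnion.2 ⟨e, Finset.mem_univ _, hT3 e w he hu⟩)
  choose T hT1 hT2 hT3 using fun v : W => h1 v (hW v.2)
  refine ⟨Finset.univ.biUnion T, fun w hw => Finset.mem_biUnion.2 ⟨⟨w, hw⟩, Finset.mem_univ _,
    hT1 _⟩, fun w hw => ?_, fun w hw u hu => ?_⟩
  · simp only [Finset.coe_biUnion, Set.mem_iUnion] at hw
    obtain ⟨e, _, he⟩ := hw
    exact hT2 e he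
  · obtain ⟨e, -, he⟩ := Finset.mem_biUnion.1 hw
    exact Finset.mem_biUnion.2 ⟨e, Finset.mem_univ _, hT3 e w he hu⟩

section

variable {V Λ κ F R : Type*} [LinearOrder Λ] [Field κ] [Field F] [Algebra κ F]
  [Field R] [Algebra κ R]

/-- `H` is built from `x` by choosing free coordinates algebraically independently and the other
ones as roots of minimal relations. -/
structure IsRealization (k : V → Λ) (S Fr : Set V) (x : V → F) (H : V → R) (E : V → Finset V)
    (f : V → Polynomial (MvPolynomial V κ)) (D : V → ℕ) : Prop where
  dep : ∀ v ∈ S, ∀ e ∈ E v, e ∈ S ∧ k e < k v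
  min : ∀ v ∈ S, ∀ W : Finset V, v ∉ W → (∀ w ∈ W, k w ≤ k v) →
    ∀ Ψ : Polynomial (MvPolynomial V κ), (∀ i, Ψ.coeff i ∈ supported κ (W : Set V)) →
      (v ∈ Fr ∨ ∀ i, D v ≤ i → Ψ.coeff i = 0) → peval x (x v) Ψ = 0 →
        ∀ i, aeval x (Ψ.coeff i) = 0
  coeff_mem : ∀ v ∈ S, v ∉ Fr → ∀ i, (f v).coeff i ∈ supported κ (E v : Set V)
  coeff_eq_zero : ∀ v ∈ S, v ∉ Fr → ∀ i, D v < i → (f v).coeff i = 0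
  root : ∀ v ∈ S, v ∉ Fr → peval x (x v) (f v) = 0
  lead : ∀ v ∈ S, v ∉ Fr → aeval x ((f v).coeff (D v)) ≠ 0
  root' : ∀ v ∈ S, v ∉ Fr → peval H (H v) (f v) = 0
  lead' : ∀ v ∈ S, v ∉ Fr → aeval H ((f v).coeff (D v)) ≠ 0
  algebraicIndependent : AlgebraicIndependent κ fun v : ↥(S ∩ Fr) => H v

variable {k : V → Λ} {S Fr : Set V} {x : V → F} {H : V → R} {E : V → Finset V}
  {f : V → Polynomial (MvPolynomial V κ)} {D : V → ℕ}

theorem IsRealization.aeval_eq_zero_of_finset (h : IsRealization k S Fr x H E f D) (s : Finset V)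
    (hsS : ↑s ⊆ S) (hs : ∀ v ∈ s, E v ⊆ s) {Φ : MvPolynomial V κ}
    (hΦ : Φ ∈ supported κ (s : Set V)) (h0 : aeval x Φ = 0) : aeval H Φ = 0 := by
  classical
  induction s using Finset.induction_on_max_value k generalizing Φ with
  | empty =>
    rw [Finset.coe_empty, supported_empty, Algebra.mem_bot] at hΦ
    obtain ⟨c, rfl⟩ := hΦ
    rw [algebraMap_eq, aeval_C] at h0 ⊢
    rw [(map_eq_zero _).1 h0, map_zero]
  | insert v s hvs hmax ih =>
    have hvS : v ∈ S := hsS (by simp)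
    have hlt : ∀ u ∈ s, u ∈ S := fun u hu => hsS (by simp [hu])
    have hEs : E v ⊆ s := fun e he => (Finset.mem_insert.1 (hs v (by simp) he)).resolve_left
      fun hev => ((h.dep v hvS e he).2).ne (congrArg k hev)
    have ih' : ∀ {Φ : MvPolynomial V κ}, Φ ∈ supported κ (s : Set V) → aeval x Φ = 0 →
        aeval H Φ = 0 := by
      refine ih hlt fun u hu e he => ?_
      refine (Finset.mem_insert.1 (hs u (by simp [hu]) he)).resolve_left fun hev => ?_
      exact ((h.dep u (hlt u hu) e he).2.trans_le (hmax u hu)).ne (congrArg k hev)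
    rw [Finset.coe_insert] at hΦ
    obtain ⟨Ψ, hΨ, rfl⟩ := exists_eval_X_eq hΦ
    rw [← peval_self] at h0 ⊢
    have base : ∀ Ψ : Polynomial (MvPolynomial V κ), (∀ i, Ψ.coeff i ∈ supported κ (s : Set V)) →
        (v ∈ Fr ∨ ∀ i, D v ≤ i → Ψ.coeff i = 0) → peval x (x v) Ψ = 0 → peval H (H v) Ψ = 0 :=
      fun Ψ hΨ hd h0 => peval_eq_zero_of_coeff fun i =>
        ih' (hΨ i) (h.min v hvS s hvs hmax Ψ hΨ hd h0 i)
    by_cases hFr : v ∈ Fr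
    · exact base Ψ hΨ (Or.inl hFr) h0
    have hN : ∀ (N : ℕ) (Ψ : Polynomial (MvPolynomial V κ)),
        (∀ i, Ψ.coeff i ∈ supported κ (s : Set V)) → (∀ i, N + D v ≤ i → Ψ.coeff i = 0) →
        peval x (x v) Ψ = 0 → peval H (H v) Ψ = 0 := by
      intro N
      induction N with
      | zero => exact fun Ψ hΨ hd => base Ψ hΨ (Or.inr fun i hi => hd i (by omega))
      | succ N ihN =>
        intro Ψ hΨ hd h0
        have hfs : ∀ i, (f v).coeff i ∈ supported κ (s : Set V) := fun i =>
          supported_mono (Finset.coe_subset.2 hEs) (h.coeff_mem v hvS hFr i)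
        have h1 := ihN (Polynomial.C ((f v).coeff (D v)) * Ψ -
          Polynomial.C (Ψ.coeff (N + D v)) * (Polynomial.X ^ N * f v)) (fun i => by
            rw [Polynomial.coeff_sub, Polynomial.coeff_C_mul, Polynomial.coeff_C_mul,
              Polynomial.coeff_X_pow_mul']
            refine sub_mem (mul_mem (hfs _) (hΨ _)) (mul_mem (hΨ _) ?_)
            split_ifs
            exacts [hfs _, zero_mem _]) (fun i hi => by
            rw [Polynomial.coeff_sub, Polynomial.coeff_C_mul, Polynomial.coeff_C_mul,
              Polynomial.coeff_X_pow_mul', if_pos (by omega)]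
            rcases hi.eq_or_lt with rfl | hi
            · rw [Nat.add_sub_cancel_left]
              ring
            · rw [hd i (by omega), h.coeff_eq_zero v hvS hFr (i - N) (by omega)]
              ring) (by
            have := h.root v hvS hFr
            simp only [peval] at this h0 ⊢
            rw [Polynomial.eval₂_sub, Polynomial.eval₂_mul, Polynomial.eval₂_mul,
              Polynomial.eval₂_mul, this, h0, mul_zero, mul_zero, mul_zero, sub_zero])
        have h2 := h.root' v hvS hFr
        simp only [peval] at h1 h2 ⊢
        rw [Polynomial.eval₂_sub, Polynomial.eval₂_mul, Polynomial.eval₂_mul, Polynomial.eval₂_mul,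
          h2, mul_zero, mul_zero, sub_zero, Polynomial.eval₂_C] at h1
        exact (mul_eq_zero.1 h1).resolve_left (h.lead' v hvS hFr)
    exact hN (Ψ.natDegree + 1) Ψ hΨ
      (fun i hi => Polynomial.coeff_eq_zero_of_natDegree_lt (by omega)) h0

theorem IsRealization.aeval_eq_zero [WellFoundedLT Λ] (h : IsRealization k S Fr x H E f D) {Φ : MvPolynomial V κ}
    (hΦ : Φ ∈ supported κ S) (h0 : aeval x Φ = 0) : aeval H Φ = 0 := by
  obtain ⟨T, hT, hTS, hTE⟩ := exists_finset_closed k S E h.dep Φ.vars (mem_supported.1 hΦ)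
  exact h.aeval_eq_zero_of_finset T hTS hTE (mem_supported.2 (Finset.coe_subset.2 hT)) h0

theorem IsRealization.aeval_eq_zero_iff [WellFoundedLT Λ] (h : IsRealization k S Fr x H E f D)
    {Φ : MvPolynomial V κ} (hΦ : Φ ∈ supported κ S) : aeval x Φ = 0 ↔ aeval H Φ = 0 := by
  classical
  refine ⟨h.aeval_eq_zero hΦ, fun hH => ?_⟩
  by_contra hx
  let A := MvPolynomial ↥(S ∩ Fr) κ
  let ι : A →ₐ[κ] MvPolynomial V κ := rename Subtype.val
  have hι : ∀ Θ : A, ι Θ ∈ supported κ S := fun Θ => by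
    rw [mem_supported]
    intro w hw
    obtain ⟨u, -, rfl⟩ := Finset.mem_image.1 (vars_rename _ _ hw)
    exact u.2.1
  let φ : A →+* F := ((aeval x : MvPolynomial V κ →ₐ[κ] F).comp ι).toRingHom
  have hinj : Function.Injective φ := by
    rw [injective_iff_map_eq_zero]
    intro Θ hΘ
    have h1 := h.aeval_eq_zero (hι Θ) hΘ
    rw [aeval_rename] at h1
    exact (injective_iff_map_eq_zero _).1 h.algebraicIndependent Θ h1
  let : Algebra A F := φ.toAlgebra
  have halg : ∀ v ∈ S, IsAlgebraic A (x v) := by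
    intro v
    induction v using (InvImage.wf k (wellFounded_lt (α := Λ))).induction with
    | _ v ih =>
      intro hv
      by_cases hFr : v ∈ Fr
      · have h1 : x v = algebraMap A F (X ⟨v, hv, hFr⟩) := by
          change x v = aeval x (rename Subtype.val (X _))
          simp
        rw [h1]
        exact isAlgebraic_algebraMap _
      · have h2 : (f v).map (aeval x : MvPolynomial V κ →ₐ[κ] F).toRingHom ∈
            Polynomial.lifts (algebraMap (Subalgebra.algebraicClosure A F) F) := by
          rw [Polynomial.lifts_iff_coeff_lifts]
          intro i
          rw [Polynomial.coeff_map]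
          refine ⟨⟨_, aeval_mem_of_mem_supported
            (K := (Subalgebra.algebraicClosure A F).toSubring) (fun c => ?_) (fun e he => ?_)
            (h.coeff_mem v hv hFr i)⟩, rfl⟩
          · have h3 : algebraMap κ F c = algebraMap A F (C c) := by
              change _ = aeval x (rename Subtype.val (C c))
              simp
            rw [h3]
            exact (Subalgebra.algebraicClosure A F).algebraMap_mem _
          · exact ih e (h.dep v hv e he).2 (h.dep v hv e he).1
        obtain ⟨q, hq⟩ := (Polynomial.mem_lifts _).1 h2
        refine IsAlgebraic.restrictScalars A (S := Subalgebra.algebraicClosure A F) ⟨q, ?_, ?_⟩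
        · rintro rfl
          have h4 := congrArg (fun p => Polynomial.coeff p (D v)) hq
          simp only [Polynomial.map_zero, Polynomial.coeff_zero, Polynomial.coeff_map] at h4
          exact h.lead v hv hFr h4.symm
        · rw [Polynomial.aeval_def, ← Polynomial.eval_map, hq, Polynomial.eval_map]
          exact h.root v hv hFr
  have hr : IsAlgebraic A (aeval x Φ) := by
    refine aeval_mem_of_mem_supported (K := (Subalgebra.algebraicClosure A F).toSubring)
      (fun c => ?_) halg hΦ
    have h3 : algebraMap κ F c = algebraMap A F (C c) := by
      change _ = aeval x (rename Subtype.val (C c))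
      simp
    rw [h3]
    exact (Subalgebra.algebraicClosure A F).algebraMap_mem _
  obtain ⟨q, hq0, hq⟩ := hr.exists_nonzero_coeff_and_aeval_eq_zero
    (mem_nonZeroDivisors_of_ne_zero hx)
  have h1 : aeval x (q.eval₂ ι.toRingHom Φ) = 0 := by
    rw [← AlgHom.coe_toRingHom, Polynomial.hom_eval₂]
    exact hq
  have h2 : q.eval₂ ι.toRingHom Φ ∈ supported κ S := by
    rw [Polynomial.eval₂_eq_sum]
    exact sum_mem fun i _ => mul_mem (hι _) (pow_mem hΦ _)
  have h3 := h.aeval_eq_zero h2 h1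
  rw [← AlgHom.coe_toRingHom, Polynomial.hom_eval₂, AlgHom.coe_toRingHom, hH,
    Polynomial.eval₂_at_zero] at h3
  have h4 : aeval H (rename Subtype.val (q.coeff 0)) = 0 := h3
  rw [aeval_rename] at h4
  exact hq0 ((injective_iff_map_eq_zero _).1 h.algebraicIndependent _ h4)

end

end

section

open MvPolynomial

section

variable {d n : ℕ} {κ F : Type*} [CommRing κ] [Field F] [Algebra κ F]

theorem aeval_congr_of_vars {σ κ A : Type*} [CommRing κ] [CommRing A] [Algebra κ A] {z z' : σ → A}
    {Φ : MvPolynomial σ κ} (h : ∀ b ∈ Φ.vars, z b = z' b) : aeval z Φ = aeval z' Φ :=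
  eval₂Hom_congr' rfl (fun b hb _ => h b hb) rfl

theorem eval_X_mem_supported {σ : Type*} {B : Set σ} {a : σ} {Ψ : Polynomial (MvPolynomial σ κ)}
    (hB : ∀ i, Ψ.coeff i ∈ supported κ B) : Ψ.eval (X a) ∈ supported κ (insert a B) := by
  rw [Polynomial.eval_eq_sum]
  refine sum_mem fun i _ => mul_mem (supported_mono (Set.subset_insert a B) (hB i)) (pow_mem ?_ _)
  rw [supported_eq_adjoin_X]
  exact Algebra.subset_adjoin ⟨a, Set.mem_insert a B, rfl⟩

theorem Indiscernible.aeval_comp_iff {J τ : Type*} {x : (Fin d → J) × Fin n → F}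
    (hx : Indiscernible κ x) {p q : τ → (Fin d → J) × Fin n} {w : Fin d → J → J} {C : Set J}
    (hw : ∀ l, Set.InjOn (w l) C) {B : Set τ} (hC : ∀ i ∈ B, ∀ l, (p i).1 l ∈ C)
    (hq : ∀ i ∈ B, coordMap w (p i) = q i) {Φ : MvPolynomial τ κ} (hΦ : Φ ∈ supported κ B) :
    aeval (x ∘ p) Φ = 0 ↔ aeval (x ∘ q) Φ = 0 := by
  classical
  have hB := mem_supported.1 hΦ
  have h := hx (Φ.vars.biUnion fun i => Finset.univ.image (p i).1) w
    (fun l => (hw l).mono fun j hj => by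
      simp only [Finset.coe_biUnion, Set.mem_iUnion, Finset.coe_image, Set.mem_image] at hj
      obtain ⟨i, hi, l', _, rfl⟩ := hj
      exact hC i (hB hi) l') (rename p Φ) (fun v hv l => by
      obtain ⟨i, hi, rfl⟩ := Finset.mem_image.1 (vars_rename _ _ hv)
      exact Finset.mem_biUnion.2 ⟨i, hi, Finset.mem_image_of_mem _ (Finset.mem_univ l)⟩)
  rw [aeval_rename, aeval_rename] at h
  rw [h, aeval_congr_of_vars (z' := x ∘ q)]
  exact fun i hi => congrArg x (hq i (hB hi))

theorem Indiscernible.peval_comp_iff {J τ : Type*} {x : (Fin d → J) × Fin n → F}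
    (hx : Indiscernible κ x) {p q : τ → (Fin d → J) × Fin n} {w : Fin d → J → J} {C : Set J}
    (hw : ∀ l, Set.InjOn (w l) C) {B : Set τ} {a : τ} (hC : ∀ i ∈ insert a B, ∀ l, (p i).1 l ∈ C)
    (hq : ∀ i ∈ insert a B, coordMap w (p i) = q i) {Ψ : Polynomial (MvPolynomial τ κ)}
    (hΨ : ∀ i, Ψ.coeff i ∈ supported κ B) :
    peval (x ∘ p) (x (p a)) Ψ = 0 ↔ peval (x ∘ q) (x (q a)) Ψ = 0 := by
  have h := hx.aeval_comp_iff hw hC hq (eval_X_mem_supported hΨ)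
  rwa [← peval_self, ← peval_self] at h

end

section

variable {d n : ℕ}

/-- The pattern of an index: real coordinates are replaced by the wildcard `none`. -/
def indexPattern : (Fin d → ℕ ⊕ ℝ) × Fin n → (Fin d → Option ℕ) × Fin n :=
  coordMap fun _ => Sum.elim some fun _ => none

/-- Replace the wildcards of a pattern by the coordinates of `v`. -/
def fillPattern (v : Fin d → ℕ ⊕ ℝ) : (Fin d → Option ℕ) × Fin n → (Fin d → ℕ ⊕ ℝ) × Fin n :=
  coordMap fun l o => o.elim (v l) Sum.inl

/-- The set of wildcards of a pattern. -/
def wildcards (a : (Fin d → Option ℕ) × Fin n) : Finset (Fin d) :=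
  Finset.univ.filter fun l => a.1 l = none

/-- An enumeration of all patterns with more wildcards coming later. -/
def patternKey (a : (Fin d → Option ℕ) × Fin n) : ℕ ×ₗ ℕ :=
  toLex ((wildcards a).card, Encodable.encode a)

/-- The patterns preceding `a` having no wildcards outside those of `a`. -/
def precedingPatterns (a : (Fin d → Option ℕ) × Fin n) : Set ((Fin d → Option ℕ) × Fin n) :=
  {b | wildcards b ⊆ wildcards a ∧ patternKey b < patternKey a}

theorem mem_wildcards {a : (Fin d → Option ℕ) × Fin n} {l : Fin d} :
    l ∈ wildcards a ↔ a.1 l = none := by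
  simp [wildcards]

theorem indexPattern_eq_none {v : (Fin d → ℕ ⊕ ℝ) × Fin n} {l : Fin d} :
    (indexPattern v).1 l = none ↔ ∃ r, v.1 l = Sum.inr r := by
  rw [indexPattern, coordMap]
  cases h : v.1 l <;> simp [h]

theorem patternKey_injective :
    Function.Injective (patternKey : (Fin d → Option ℕ) × Fin n → ℕ ×ₗ ℕ) := fun _ _ h =>
  Encodable.encode_injective (congrArg (fun p => (ofLex p).2) h)

theorem fillPattern_indexPattern (v : (Fin d → ℕ ⊕ ℝ) × Fin n) :
    fillPattern v.1 (indexPattern v) = v := by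
  refine Prod.ext (funext fun l => ?_) rfl
  simp only [fillPattern, indexPattern, coordMap]
  cases h : v.1 l <;> simp

theorem indexPattern_fillPattern {v : (Fin d → ℕ ⊕ ℝ) × Fin n} {b : (Fin d → Option ℕ) × Fin n}
    (h : wildcards b ⊆ wildcards (indexPattern v)) : indexPattern (fillPattern v.1 b) = b := by
  refine Prod.ext (funext fun l => ?_) rfl
  simp only [fillPattern, indexPattern, coordMap]
  cases hb : b.1 l with
  | some m => simp
  | none =>
    obtain ⟨r, hr⟩ := indexPattern_eq_none.1 (mem_wildcards.1 (h (mem_wildcards.2 hb)))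
    simp [hr]

variable {κ F : Type*} [CommRing κ] [Field F] [Algebra κ F] {x : (Fin d → ℕ ⊕ ℝ) × Fin n → F}

/-- Map on coordinates turning `inr 0` into the real coordinates of `v`. -/
theorem exists_coordMap_fillPattern (v : (Fin d → ℕ ⊕ ℝ) × Fin n) :
    ∃ w : Fin d → ℕ ⊕ ℝ → ℕ ⊕ ℝ, (∀ l, Set.InjOn (w l) (insert (Sum.inr 0) (Set.range Sum.inl))) ∧
      ∀ b : (Fin d → Option ℕ) × Fin n, wildcards b ⊆ wildcards (indexPattern v) →
        coordMap w (fillPattern (fun _ => Sum.inr 0) b) = fillPattern v.1 b := by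
  refine ⟨fun l => Sum.elim Sum.inl fun _ => Sum.elim (fun _ => Sum.inr 0) Sum.inr (v.1 l),
    fun l => ?_, fun b hb => ?_⟩
  · have h1 : ∀ m, Sum.inl m ≠ (Sum.elim (fun _ => Sum.inr 0) Sum.inr (v.1 l) : ℕ ⊕ ℝ) := by
      intro m
      cases v.1 l <;> simp
    rintro i (rfl | ⟨i, rfl⟩) j (rfl | ⟨j, rfl⟩) h
    · rfl
    · exact absurd h.symm (h1 j)
    · exact absurd h (h1 i)
    · exact h
  · refine Prod.ext (funext fun l => ?_) rfl
    simp only [fillPattern, coordMap]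
    cases hbl : b.1 l with
    | some m => simp
    | none =>
      obtain ⟨r, hr⟩ := indexPattern_eq_none.1 (mem_wildcards.1 (hb (mem_wildcards.2 hbl)))
      simp [hr]

theorem fillPattern_mem (b : (Fin d → Option ℕ) × Fin n) (l : Fin d) :
    (fillPattern (fun _ => Sum.inr 0) b).1 l ∈
      (insert (Sum.inr 0) (Set.range Sum.inl) : Set (ℕ ⊕ ℝ)) := by
  simp only [fillPattern, coordMap]
  cases b.1 l <;> simp

theorem Indiscernible.aeval_fillPattern_iff (hx : Indiscernible κ x)
    (v : (Fin d → ℕ ⊕ ℝ) × Fin n) {Φ : MvPolynomial ((Fin d → Option ℕ) × Fin n) κ}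
    (hΦ : Φ ∈ supported κ (precedingPatterns (indexPattern v))) :
    aeval (x ∘ fillPattern fun _ => Sum.inr 0) Φ = 0 ↔ aeval (x ∘ fillPattern v.1) Φ = 0 := by
  obtain ⟨w, hw, h⟩ := exists_coordMap_fillPattern v
  exact hx.aeval_comp_iff hw (fun b _ => fillPattern_mem b) (fun b hb => h b hb.1) hΦ

theorem Indiscernible.peval_fillPattern_iff (hx : Indiscernible κ x)
    (v : (Fin d → ℕ ⊕ ℝ) × Fin n) {Ψ : Polynomial (MvPolynomial ((Fin d → Option ℕ) × Fin n) κ)}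
    (hΨ : ∀ i, Ψ.coeff i ∈ supported κ (precedingPatterns (indexPattern v))) :
    peval (x ∘ fillPattern fun _ => Sum.inr 0)
        (x (fillPattern (fun _ => Sum.inr 0) (indexPattern v))) Ψ = 0 ↔
      peval (x ∘ fillPattern v.1) (x v) Ψ = 0 := by
  obtain ⟨w, hw, h⟩ := exists_coordMap_fillPattern v
  have := hx.peval_comp_iff hw (fun b _ => fillPattern_mem b)
    (fun b (hb : b ∈ insert (indexPattern v) (precedingPatterns (indexPattern v))) => h b (by
      rcases hb with rfl | hb
      exacts [subset_rfl, hb.1])) hΨ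
  rwa [fillPattern_indexPattern] at this

theorem exists_collapse (v : (Fin d → ℕ ⊕ ℝ) × Fin n) (W : Finset ((Fin d → ℕ ⊕ ℝ) × Fin n))
    (hv : v ∉ W) (hW : ∀ w ∈ W, patternKey (indexPattern w) ≤ patternKey (indexPattern v)) :
    ∃ (π : (Fin d → ℕ ⊕ ℝ) × Fin n → (Fin d → Option ℕ) × Fin n)
      (w : Fin d → ℕ ⊕ ℝ → ℕ ⊕ ℝ) (C : Set (ℕ ⊕ ℝ)), (∀ l, Set.InjOn (w l) C) ∧
      (∀ i ∈ insert v (W : Set _), ∀ l, i.1 l ∈ C) ∧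
      (∀ i, coordMap w i = fillPattern (fun _ => Sum.inr 0) (π i)) ∧
      π v = indexPattern v ∧ ∀ i ∈ W, π i ∈ precedingPatterns (indexPattern v) := by
  classical
  let C : Finset (ℕ ⊕ ℝ) := (insert v W).biUnion fun i => Finset.univ.image i.1
  obtain ⟨g₀, hg₀⟩ := Set.countable_iff_exists_injOn.1 C.toRight.countable_toSet
  let N := C.toLeft.sup id + 1
  have hN : ∀ m, Sum.inl m ∈ C → m < N := fun m hm =>
    Nat.lt_succ_of_le (Finset.le_sup (f := id) (Finset.mem_toLeft.2 hm))
  let m : Fin d → ℕ ⊕ ℝ → Option ℕ := fun l => Sum.elim some fun r =>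
    if v.1 l = Sum.inr r then none else some (N + g₀ r)
  have hm : ∀ l j, m l j = none → ∃ r, j = Sum.inr r ∧ v.1 l = Sum.inr r := by
    intro l j h
    rcases j with j | r
    · simp [m] at h
    · refine ⟨r, rfl, ?_⟩
      by_contra h'
      simp [m, h'] at h
  have hminj : ∀ l, Set.InjOn (m l) C := by
    rintro l (i | i) hi (j | j) hj hij
    · simpa [m] using hij
    · have := hN i hi
      simp only [m, Sum.elim_inl, Sum.elim_inr] at hij
      split_ifs at hij
      rw [Option.some_inj] at hij
      omega
    · have := hN j hj
      simp only [m, Sum.elim_inl, Sum.elim_inr] at hij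
      split_ifs at hij
      rw [Option.some_inj] at hij
      omega
    · simp only [m, Sum.elim_inr] at hij
      split_ifs at hij with h1 h2 h2
      · rw [← h1, ← h2]
      · rw [Option.some_inj, Nat.add_left_cancel_iff] at hij
        exact congrArg _ (hg₀ (by simpa using hi) (by simpa using hj) hij)
  have hfill : Function.Injective fun o : Option ℕ => (o.elim (Sum.inr 0) Sum.inl : ℕ ⊕ ℝ) := by
    rintro (_ | i) (_ | j) h <;> simp_all
  refine ⟨coordMap m, fun l => (fun o => o.elim (Sum.inr 0) Sum.inl) ∘ m l, C,
    fun l => hfill.comp_injOn (hminj l), fun i hi l => ?_, fun i => rfl, ?_, fun w hw => ?_⟩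
  · exact Finset.mem_biUnion.2 ⟨i, by simpa using hi,
      Finset.mem_image_of_mem _ (Finset.mem_univ l)⟩
  · refine Prod.ext (funext fun l => ?_) rfl
    simp only [coordMap, indexPattern, m]
    cases h : v.1 l <;> simp
  have h1 : wildcards (coordMap m w) ⊆ wildcards (indexPattern v) := by
    intro l hl
    obtain ⟨r, -, hr⟩ := hm l _ (mem_wildcards.1 hl)
    exact mem_wildcards.2 (indexPattern_eq_none.2 ⟨r, hr⟩)
  have h2 : wildcards (coordMap m w) ⊆ wildcards (indexPattern w) := by
    intro l hl
    obtain ⟨r, hr, -⟩ := hm l _ (mem_wildcards.1 hl)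
    exact mem_wildcards.2 (indexPattern_eq_none.2 ⟨r, hr⟩)
  refine ⟨h1, ?_⟩
  rcases (Finset.card_le_card h1).lt_or_eq with h3 | h3
  · exact Prod.Lex.lt_iff.2 (Or.inl h3)
  have h4 : (wildcards (indexPattern w)).card ≤ (wildcards (indexPattern v)).card :=
    Prod.Lex.monotone_fst _ _ (hW w hw)
  have h5 := Finset.eq_of_subset_of_card_le h1 h3.ge
  have h6 := Finset.eq_of_subset_of_card_le h2 (h4.trans h3.ge)
  have h7 : coordMap m w = indexPattern w := by
    refine Prod.ext (funext fun l => ?_) rfl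
    by_cases hl : l ∈ wildcards (indexPattern w)
    · rw [mem_wildcards.1 hl]
      exact mem_wildcards.1 (h6 ▸ hl)
    · rw [mem_wildcards, indexPattern_eq_none] at hl
      simp only [coordMap, indexPattern, m]
      cases h : w.1 l with
      | inl i => simp
      | inr r => exact absurd ⟨r, h⟩ hl
  rw [h7]
  refine (hW w hw).lt_of_ne fun h8 => hv ?_
  have h9 := patternKey_injective h8
  suffices w = v from this ▸ hw
  have h12 := congrArg Prod.snd h9
  refine Prod.ext (funext fun l => ?_) h12
  by_cases hl : l ∈ wildcards (coordMap m w)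
  · obtain ⟨r, hr, hr'⟩ := hm l _ (mem_wildcards.1 hl)
    exact hr.trans hr'.symm
  · rw [h6, mem_wildcards, indexPattern_eq_none] at hl
    have h11 := congrFun (congrArg Prod.fst h9) l
    simp only [indexPattern, coordMap] at h11
    rcases hw1 : w.1 l with i | i <;> rcases hv1 : v.1 l with j | j <;> simp_all

theorem Indiscernible.aeval_eq_zero_of_peval (hx : Indiscernible κ x)
    (v : (Fin d → ℕ ⊕ ℝ) × Fin n) (W : Finset ((Fin d → ℕ ⊕ ℝ) × Fin n)) (hv : v ∉ W)
    (hW : ∀ w ∈ W, patternKey (indexPattern w) ≤ patternKey (indexPattern v))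
    (Q : Polynomial (MvPolynomial ((Fin d → Option ℕ) × Fin n) κ) → Prop)
    (hQ : ∀ Ψ, Q Ψ → (∀ i, Ψ.coeff i ∈ supported κ (precedingPatterns (indexPattern v))) →
      peval (x ∘ fillPattern fun _ => Sum.inr 0)
        (x (fillPattern (fun _ => Sum.inr 0) (indexPattern v))) Ψ = 0 →
      ∀ i, aeval (x ∘ fillPattern fun _ => Sum.inr 0) (Ψ.coeff i) = 0)
    (Ψ : Polynomial (MvPolynomial ((Fin d → ℕ ⊕ ℝ) × Fin n) κ))
    (hΨ : ∀ i, Ψ.coeff i ∈ supported κ (W : Set _))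
    (hΨQ : ∀ π : _ → (Fin d → Option ℕ) × Fin n,
      Q (Ψ.map (rename π : MvPolynomial _ κ →ₐ[κ] _).toRingHom))
    (h0 : peval x (x v) Ψ = 0) (i : ℕ) : aeval x (Ψ.coeff i) = 0 := by
  classical
  obtain ⟨π, w, C, hw, hC, hπ, hπv, hπW⟩ := exists_collapse v W hv hW
  have h1 := (hx.peval_comp_iff (p := id) hw hC (fun i _ => hπ i) hΨ).1 h0
  rw [hπv] at h1
  have h2 := hQ _ (hΨQ π) (fun i => by
    rw [Polynomial.coeff_map, mem_supported]
    intro b hb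
    obtain ⟨u, hu, rfl⟩ := Finset.mem_image.1 (vars_rename _ _ hb)
    exact hπW u (mem_supported.1 (hΨ i) hu)) (by rw [peval_map_rename]; exact h1) i
  rw [Polynomial.coeff_map] at h2
  have h3 : aeval (x ∘ fun i => fillPattern (fun _ => Sum.inr 0) (π i)) (Ψ.coeff i) = 0 := by
    rw [← h2]
    exact (aeval_rename π (x ∘ fillPattern fun _ => Sum.inr 0) (Ψ.coeff i)).symm
  exact (hx.aeval_comp_iff (p := id) hw (fun i hi => hC i (Or.inr hi)) (fun i _ => hπ i)
    (hΨ i)).2 h3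

end

end

section

open MvPolynomial

theorem mk_index_le_continuum (d n : ℕ) : #((Fin d → ℕ ⊕ ℝ) × Fin n) ≤ 𝔠 := by
  have h1 : #(Fin d → ℕ ⊕ ℝ) ≤ 𝔠 := by
    rw [← Cardinal.power_def, mk_sum]
    simp only [lift_uzero, mk_nat, mk_real, aleph0_add_continuum, mk_fin]
    exact_mod_cast Cardinal.power_nat_le aleph0_le_continuum
  rw [mk_prod, lift_id, lift_id, mk_fin]
  calc _ ≤ 𝔠 * 𝔠 := mul_le_mul' h1 (nat_lt_continuum n).le
    _ = 𝔠 := continuum_mul_self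

section

variable {d n : ℕ}

/-- Values for the coordinates in `Y` preceding a pattern, by recursion, and default values `z` for
the other ones. -/
theorem exists_pattern_recursion {κ : Subfield ℝ} (Free : (Fin d → Option ℕ) × Fin n → Prop)
    (f : (Fin d → Option ℕ) × Fin n → Polynomial (MvPolynomial ((Fin d → Option ℕ) × Fin n) κ))
    (c : (Fin d → Option ℕ) × Fin n → MvPolynomial ((Fin d → Option ℕ) × Fin n) κ)
    (Y : Finset ((Fin d → Option ℕ) × Fin n)) (z ε : (Fin d → Option ℕ) × Fin n → ℝ)
    (hε : ∀ b, 0 < ε b)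
    (h : ∀ a ∈ Y, ∀ u : (Fin d → Option ℕ) × Fin n → ℝ,
      (∀ b, ¬ patternKey b < patternKey a → u b = z b) → (∀ b, |u b - z b| < ε b) → ¬ Free a →
        aeval u (c a) ≠ 0 ∧ ∃ w, |w - z a| < ε a ∧ peval u w (f a) = 0)
    (t : (Fin d → ℕ ⊕ ℝ) × Fin n → ℝ)
    (ht : ∀ v, |t v - z (indexPattern v)| < ε (indexPattern v)) :
    ∃ H : (Fin d → ℕ ⊕ ℝ) × Fin n → ℝ, (∀ v, Free (indexPattern v) → H v = t v) ∧
      ∀ v, indexPattern v ∈ Y → ¬ Free (indexPattern v) → ∃ u : (Fin d → Option ℕ) × Fin n → ℝ,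
        (∀ b ∈ Y, b ∈ precedingPatterns (indexPattern v) → H (fillPattern v.1 b) = u b) ∧
        aeval u (c (indexPattern v)) ≠ 0 ∧ peval u (H v) (f (indexPattern v)) = 0 := by
  classical
  have hwf : WellFounded (InvImage (· < ·) fun v : (Fin d → ℕ ⊕ ℝ) × Fin n =>
    patternKey (indexPattern v)) := InvImage.wf _ wellFounded_lt
  let step : ∀ v : (Fin d → ℕ ⊕ ℝ) × Fin n,
      (∀ u, patternKey (indexPattern u) < patternKey (indexPattern v) → ℝ) → ℝ := fun v ih =>
    if Free (indexPattern v) then t v else Classical.epsilon fun w =>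
      |w - z (indexPattern v)| < ε (indexPattern v) ∧
        peval (fun b => if hb : b ∈ Y ∧ b ∈ precedingPatterns (indexPattern v) then
          ih (fillPattern v.1 b) (by rw [indexPattern_fillPattern hb.2.1]; exact hb.2.2)
          else z b) w (f (indexPattern v)) = 0
  let H := hwf.fix step
  have hH : ∀ v, H v = step v fun u _ => H u := fun v => hwf.fix_eq step v
  let U : (Fin d → ℕ ⊕ ℝ) × Fin n → (Fin d → Option ℕ) × Fin n → ℝ := fun v b =>
    if b ∈ Y ∧ b ∈ precedingPatterns (indexPattern v) then H (fillPattern v.1 b) else z b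
  have hfree : ∀ v, Free (indexPattern v) → H v = t v := fun v hv => by
    rw [hH]
    exact if_pos hv
  have hroot : ∀ v, ¬ Free (indexPattern v) → H v = Classical.epsilon fun w =>
      |w - z (indexPattern v)| < ε (indexPattern v) ∧
        peval (U v) w (f (indexPattern v)) = 0 := fun v hv => by
    rw [hH]
    exact if_neg hv
  have key : ∀ v, indexPattern v ∈ Y → |H v - z (indexPattern v)| < ε (indexPattern v) ∧
      (¬ Free (indexPattern v) → aeval (U v) (c (indexPattern v)) ≠ 0 ∧
        peval (U v) (H v) (f (indexPattern v)) = 0) := by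
    intro v
    induction v using hwf.induction with
    | _ v ih =>
      intro hv
      by_cases hF : Free (indexPattern v)
      · exact ⟨by rw [hfree v hF]; exact ht v, fun h => absurd hF h⟩
      obtain ⟨h1, h2⟩ := h _ hv (U v) (fun b hb => if_neg fun h => hb h.2.2) (fun b => by
        by_cases hb : b ∈ Y ∧ b ∈ precedingPatterns (indexPattern v)
        · have h3 := indexPattern_fillPattern hb.2.1
          have h4 := (ih (fillPattern v.1 b) (by
            change patternKey (indexPattern (fillPattern v.1 b)) < _
            rw [h3]
            exact hb.2.2) (h3.symm ▸ hb.1)).1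
          rw [h3] at h4
          simpa only [U, if_pos hb] using h4
        · simpa only [U, if_neg hb, sub_self, abs_zero] using hε b) hF
      have h3 := Classical.epsilon_spec h2
      rw [← hroot v hF] at h3
      exact ⟨h3.1, fun _ => ⟨h1, h3.2⟩⟩
  exact ⟨H, hfree, fun v hv hF => ⟨U v, fun b hb hb' => (if_pos ⟨hb, hb'⟩).symm, (key v hv).2 hF⟩⟩

end

theorem mem_supported_biUnion_vars {σ κ : Type*} [CommRing κ] [DecidableEq σ]
    (f : Polynomial (MvPolynomial σ κ)) (i : ℕ) :
    f.coeff i ∈ supported κ (↑(f.support.biUnion fun i => (f.coeff i).vars) : Set σ) := by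
  by_cases hi : f.coeff i = 0
  · rw [hi]
    exact zero_mem _
  · exact mem_supported.2 (Finset.coe_subset.2
      (Finset.subset_biUnion_of_mem (fun i => (f.coeff i).vars) (Polynomial.mem_support_iff.2 hi)))

/-- An indiscernible array all of whose finite parts are approximated by real arrays has a copy of
continuum size over the reals. -/
theorem exists_real_copy {d n : ℕ} (κ : Subfield ℝ) [Countable κ] {F : Type*} [Field F]
    [Algebra κ F] {x : (Fin d → ℕ ⊕ ℝ) × Fin n → F} (hx : Indiscernible κ x)
    (happ : ∀ T : Finset (MvPolynomial ((Fin d → ℕ ⊕ ℝ) × Fin n) κ),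
      ∃ y : (Fin d → ℕ ⊕ ℝ) × Fin n → ℝ, ∀ Φ ∈ T, aeval y Φ = 0 ↔ aeval x Φ = 0) :
    ∃ H : (Fin d → ℝ) × Fin n → ℝ, ∀ Φ : MvPolynomial ((Fin d → ℝ) × Fin n) κ,
      aeval (x ∘ coordMap fun _ => Sum.inr) Φ = 0 ↔ aeval H Φ = 0 := by
  classical
  have : CharZero F := charZero_of_injective_algebraMap (algebraMap κ F).injective
  let jj : (Fin d → Option ℕ) × Fin n → (Fin d → ℕ ⊕ ℝ) × Fin n := fillPattern fun _ => Sum.inr 0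
  let Free : (Fin d → Option ℕ) × Fin n → Prop := fun a =>
    IsFreeOver κ (x ∘ jj) (precedingPatterns a) a
  have hmin : ∀ a, ∃ f D, ¬ Free a →
      IsMinRel (κ := κ) (x ∘ jj) (precedingPatterns a) a f D := fun a => by
    by_cases ha : Free a
    · exact ⟨0, 0, fun h => absurd ha h⟩
    · obtain ⟨f, D, h⟩ := exists_isMinRel ha
      exact ⟨f, D, fun _ => h⟩
  choose f D hf using hmin
  let Dep : (Fin d → Option ℕ) × Fin n → Finset ((Fin d → Option ℕ) × Fin n) := fun a =>
    if Free a then ∅ else (f a).support.biUnion fun i => ((f a).coeff i).vars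
  have hDep : ∀ a, ∀ b ∈ Dep a, b ∈ precedingPatterns a := by
    intro a b hb
    by_cases ha : Free a
    · simp [Dep, ha] at hb
    · simp only [Dep, if_neg ha, Finset.mem_biUnion] at hb
      obtain ⟨i, -, hi⟩ := hb
      exact mem_supported.1 ((hf a ha).coeff_mem i) hi
  have hfDep : ∀ a, ¬ Free a → ∀ i, (f a).coeff i ∈ supported κ (Dep a : Set _) := by
    intro a ha i
    simp only [Dep, if_neg ha]
    exact mem_supported_biUnion_vars _ _
  obtain ⟨Y, hWY, -, hY⟩ := exists_finset_closed patternKey Set.univ Dep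
    (fun a _ b hb => ⟨trivial, (hDep a b hb).2⟩)
    (Finset.univ.image fun c : Fin n => ((fun _ => none, c) : (Fin d → Option ℕ) × Fin n))
    (Set.subset_univ _)
  obtain ⟨y, hy⟩ := happ (Y.biUnion fun a => {rename jj ((f a).eval (X a)),
    rename jj ((f a).derivative.eval (X a)), rename jj ((f a).coeff (D a))})
  have hz : ∀ a ∈ Y, ∀ Φ ∈ ({(f a).eval (X a), (f a).derivative.eval (X a), (f a).coeff (D a)} :
      Finset (MvPolynomial ((Fin d → Option ℕ) × Fin n) κ)),
      (aeval (y ∘ jj) Φ = 0 ↔ aeval (x ∘ jj) Φ = 0) := by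
    intro a ha Φ hΦ
    rw [← aeval_rename, ← aeval_rename]
    refine hy _ (Finset.mem_biUnion.2 ⟨a, ha, ?_⟩)
    simp only [Finset.mem_insert, Finset.mem_singleton] at hΦ ⊢
    rcases hΦ with rfl | rfl | rfl <;> simp
  obtain ⟨ε, hε, hεY⟩ := exists_tolerances patternKey (y ∘ jj) (fun a η u => ¬ Free a →
    aeval u ((f a).coeff (D a)) ≠ 0 ∧ ∃ w, |w - (y ∘ jj) a| < η ∧ peval u w (f a) = 0) Y (by
      intro a ha η hη
      by_cases hF : Free a
      · exact ⟨1, one_pos, fun _ _ h => absurd hF h⟩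
      have h1 := hf a hF
      obtain ⟨δ, hδ, h⟩ := exists_root_near (z := y ∘ jj) (a := a) (f := f a)
        (c := (f a).coeff (D a)) (by
          rw [peval_self, hz a ha _ (by simp), ← peval_self]
          exact h1.root) (by
          rw [peval_self, Ne, hz a ha _ (by simp), ← peval_self]
          exact h1.deriv) (by
          rw [Ne, hz a ha _ (by simp)]
          exact h1.lead) hη
      exact ⟨δ, hδ, fun u hu _ => h u hu⟩)
  obtain ⟨t, ht, htε⟩ := exists_algebraicIndependent_near κ (mk_index_le_continuum d n)
    (fun v => (y ∘ jj) (indexPattern v)) (fun v => ε (indexPattern v)) fun v => hε _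
  obtain ⟨H, hHt, hHf⟩ := exists_pattern_recursion Free f (fun a => (f a).coeff (D a)) Y (y ∘ jj) ε
    hε hεY t htε
  have hreal : IsRealization (fun v => patternKey (indexPattern v)) {v | indexPattern v ∈ Y}
      {v | Free (indexPattern v)} x H (fun v => (Dep (indexPattern v)).image (fillPattern v.1))
      (fun v => (f (indexPattern v)).map
        (rename (fillPattern v.1) : MvPolynomial _ κ →ₐ[κ] _).toRingHom)
      (fun v => D (indexPattern v)) :=
    { dep := by
        intro v hv e he
        obtain ⟨b, hb, rfl⟩ := Finset.mem_image.1 he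
        have h1 := hDep _ b hb
        have h2 := indexPattern_fillPattern h1.1
        refine ⟨?_, ?_⟩
        · rw [Set.mem_ofPred, h2]
          exact hY _ hv hb
        · rw [h2]
          exact h1.2
      min := by
        intro v hv W hvW hW Ψ hΨ hd h0 i
        by_cases hF : Free (indexPattern v)
        · exact hx.aeval_eq_zero_of_peval v W hvW hW (fun _ => True) (fun Ψ _ => hF Ψ) Ψ hΨ
            (fun _ => trivial) h0 i
        · refine hx.aeval_eq_zero_of_peval v W hvW hW
            (fun Ψ => ∀ i, D (indexPattern v) ≤ i → Ψ.coeff i = 0)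
            (fun Ψ hQ hΨ => (hf _ hF).min Ψ hΨ hQ) Ψ hΨ (fun π i hi => ?_) h0 i
          rw [Polynomial.coeff_map, hd.resolve_left hF i hi, map_zero]
      coeff_mem := by
        intro v _ hF i
        rw [Polynomial.coeff_map, mem_supported, Finset.coe_image]
        intro b hb
        obtain ⟨u, hu, rfl⟩ := Finset.mem_image.1 (vars_rename _ _ hb)
        exact ⟨u, mem_supported.1 (hfDep _ hF i) hu, rfl⟩
      coeff_eq_zero := by
        intro v _ hF i hi
        rw [Polynomial.coeff_map, (hf _ hF).coeff_eq_zero i hi, map_zero]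
      root := by
        intro v _ hF
        rw [peval_map_rename]
        exact (hx.peval_fillPattern_iff v (hf _ hF).coeff_mem).1 (hf _ hF).root
      lead := by
        intro v _ hF
        rw [Polynomial.coeff_map]
        refine fun h => (hf _ hF).lead ?_
        refine (hx.aeval_fillPattern_iff v ((hf _ hF).coeff_mem _)).2 ?_
        rw [← aeval_rename]
        exact h
      root' := by
        intro v hv hF
        obtain ⟨u, hu, -, h⟩ := hHf v hv hF
        rw [peval_map_rename, peval_congr (z' := u) (hfDep _ hF)]
        · exact h
        · exact fun b hb => hu b (hY _ hv hb) (hDep _ b hb)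
      lead' := by
        intro v hv hF
        obtain ⟨u, hu, h, -⟩ := hHf v hv hF
        rw [Polynomial.coeff_map]
        refine fun h0 => h ?_
        rw [← h0]
        refine Eq.trans (aeval_congr_of_vars fun b hb => ?_) (aeval_rename _ H _).symm
        have hb := mem_supported.1 (hfDep _ hF _) hb
        exact (hu b (hY _ hv hb) (hDep _ b hb)).symm
      algebraicIndependent := by
        have h1 : (fun v : ↥({v | indexPattern v ∈ Y} ∩ {v | Free (indexPattern v)}) => H v) =
            t ∘ Subtype.val := funext fun v => hHt v v.2.2
        rw [h1]
        exact ht.comp _ Subtype.val_injective }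
  refine ⟨H ∘ coordMap fun _ => Sum.inr, fun Φ => ?_⟩
  rw [← aeval_rename, ← aeval_rename]
  refine hreal.aeval_eq_zero_iff (mem_supported.2 fun v hv => ?_)
  obtain ⟨u, -, rfl⟩ := Finset.mem_image.1 (vars_rename _ _ hv)
  exact hWY (Finset.mem_image.2 ⟨u.2, Finset.mem_univ _, rfl⟩)

end

theorem mem_fimg {V W : Type*} {g : V → W} {e : Finset V} {w : W} :
    w ∈ fimg g e ↔ ∃ v ∈ e, g v = w := by
  classical
  exact Finset.mem_image

theorem fimg_fimg {V W U : Type*} (g : W → U) (f : V → W) (e : Finset V) :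
    fimg g (fimg f e) = fimg (g ∘ f) e := by
  ext u
  simp [mem_fimg]

theorem fimg_mem_LEdges {k d : ℕ} {α X Y : Type*} {P : Finset (Fin d → α)} {Q : Finset (Fin d → X)}
    (hQ : Q ∈ LEdges k P X) {ρ : Fin d → X → Y}
    (hρ : Set.InjOn (fun (r : Fin d → X) l => ρ l (r l)) Q) :
    fimg (fun (r : Fin d → X) l => ρ l (r l)) Q ∈ LEdges k P Y := by
  classical
  obtain ⟨hcard, f, h1, h2, h3⟩ := hQ
  refine ⟨?_, fun x l => ρ l (f x l), fun x hx => mem_fimg.2 ⟨f x, h1 x hx, rfl⟩, fun y hy => ?_,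
    fun x hx y hy i hi => congrArg (ρ i) (h3 x hx y hy i hi)⟩
  · rw [← hcard]
    unfold fimg
    convert Finset.card_image_of_injOn hρ
  · obtain ⟨q, hq, rfl⟩ := mem_fimg.1 hy
    obtain ⟨x, hx, rfl⟩ := h2 q hq
    exact ⟨x, hx, rfl⟩

theorem Embeddable.LEdges_of_injective {k d : ℕ} {α X Y V : Type*} {P : Finset (Fin d → α)}
    {E : Set (Finset V)} (h : Embeddable (LEdges k P Y) E) {ι : X → Y}
    (hι : Function.Injective ι) : Embeddable (LEdges k P X) E := by
  obtain ⟨g, hg, hE⟩ := h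
  have hinj : Function.Injective fun (r : Fin d → X) l => ι (r l) := hι.comp_left
  refine ⟨_, hg.comp hinj, fun e he => ?_⟩
  rw [← fimg_fimg]
  exact hE _ (fimg_mem_LEdges (ρ := fun _ => ι) he hinj.injOn)

open MvPolynomial in
theorem exists_countable_subfield_map_eq {σ : Type*} (p : MvPolynomial σ ℝ) :
    ∃ (κ : Subfield ℝ) (_ : Countable κ) (p₀ : MvPolynomial σ κ),
      ∀ y : σ → ℝ, aeval y p₀ = eval y p := by
  let κ := Subfield.closure (p.coeffs : Set ℝ)
  have hκ : Countable κ := by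
    rw [← Cardinal.mk_le_aleph0_iff]
    refine (Subfield.cardinalMk_closure_le_max _).trans (max_le ?_ le_rfl)
    exact Cardinal.mk_le_aleph0
  obtain ⟨p₀, hp₀⟩ := (mem_range_map_iff_coeffs_subset (f := algebraMap κ ℝ) (x := p)).2 (by
    intro c hc
    exact ⟨⟨c, Subfield.subset_closure hc⟩, rfl⟩)
  exact ⟨κ, hκ, p₀, fun y => by rw [← hp₀, eval_map, aeval_def]⟩

theorem exists_perm_of_fimg_eq {k : ℕ} {V W : Type*} {a : Fin k → V} {a' : Fin k → W} {g : V → W}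
    (ha' : Function.Injective a') (h : fimg a' Finset.univ = fimg g (fimg a Finset.univ)) :
    ∃ σ : Equiv.Perm (Fin k), ∀ i, a' i = g (a (σ i)) := by
  have h1 : ∀ i, ∃ j, a' i = g (a j) := by
    intro i
    have : a' i ∈ fimg g (fimg a Finset.univ) := h ▸ mem_fimg.2 ⟨i, Finset.mem_univ _, rfl⟩
    rw [fimg_fimg] at this
    obtain ⟨j, -, hj⟩ := mem_fimg.1 this
    exact ⟨j, hj.symm⟩
  choose σ hσ using h1
  have hinj : Function.Injective σ := fun i j hij => ha' (by rw [hσ, hσ, hij])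
  exact ⟨Equiv.ofBijective σ (Finite.injective_iff_bijective.1 hinj), hσ⟩

open MvPolynomial in
theorem embeddable_LEdges_real {k n d : ℕ} {p : MvPolynomial (Fin k × Fin n) ℝ} {α : Type*}
    {P : Finset (Fin d → α)} (h : ∀ M : ℕ, Embeddable (LEdges k P (Fin M)) (zeroEdges k n p)) :
    Embeddable (LEdges k P ℝ) (zeroEdges k n p) := by
  classical
  obtain ⟨κ, hκ, p₀, hp₀⟩ := exists_countable_subfield_map_eq p
  choose g hginj hg using h
  obtain ⟨F, _, _, x, hx, hxg⟩ := exists_orderIndiscernible_array κ g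
  let ι : ℕ ⊕ ℝ → ℝ := Sum.elim (fun m => -m) Real.exp
  have hι : Function.Injective ι := by
    have hne : ∀ (m : ℕ) (r : ℝ), -(m : ℝ) ≠ Real.exp r := fun m r hmr => by
      have := Real.exp_pos r
      have : (0 : ℝ) ≤ m := m.cast_nonneg
      linarith
    rintro (i | i) (j | j) hij
    · simpa [ι] using hij
    · exact absurd hij (hne i j)
    · exact absurd hij.symm (hne j i)
    · exact congrArg _ (Real.exp_injective hij)
  obtain ⟨H, hH⟩ := exists_real_copy κ (hx.indiscernible hι) (fun T => by
    obtain ⟨y, M, ρ, hy, -⟩ := hxg (T.image (rename (coordMap fun _ => ι))) ∅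
    refine ⟨y ∘ coordMap fun _ => ι, fun Φ hΦ => ?_⟩
    rw [← aeval_rename, ← aeval_rename]
    exact hy _ (Finset.mem_image_of_mem _ hΦ))
  -- Transfer of vanishing from finite approximations to the real copy.
  have htrans : ∀ (T : Finset (MvPolynomial ((Fin d → ℝ) × Fin n) κ)) (R : Finset (Fin d → ℝ)),
      ∃ (M : ℕ) (ρ : Fin d → ℝ → Fin M) (z : (Fin d → ℝ) × Fin n → ℝ),
        Set.InjOn (fun (r : Fin d → ℝ) l => ρ l (r l)) R ∧
        (∀ r ∈ R, ∀ c, z (r, c) = g M (fun l => ρ l (r l)) c) ∧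
        ∀ Φ ∈ T, aeval z Φ = 0 ↔ aeval H Φ = 0 := by
    intro T R
    obtain ⟨y, M, ρ, hy, hρ, hyg⟩ := hxg (T.image (rename (coordMap fun _ => Real.exp)))
      (R.biUnion fun r => Finset.univ.image fun l => Real.exp (r l))
    have hR : ∀ r ∈ R, ∀ l, Real.exp (r l) ∈
        R.biUnion fun r => Finset.univ.image fun l => Real.exp (r l) := fun r hr l =>
      Finset.mem_biUnion.2 ⟨r, hr, Finset.mem_image_of_mem _ (Finset.mem_univ l)⟩
    refine ⟨M, fun l r => ρ l (Real.exp r), y ∘ coordMap fun _ => Real.exp, ?_, ?_, ?_⟩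
    · intro r hr r' hr' hrr'
      exact funext fun l =>
        Real.exp_injective (hρ l (hR r hr l) (hR r' hr' l) (congrFun hrr' l))
    · exact fun r hr c => hyg _ (hR r hr) c
    · intro Φ hΦ
      rw [← hH, ← aeval_rename, hy _ (Finset.mem_image_of_mem _ hΦ), aeval_rename]
      rfl
  have hinj : Function.Injective fun (r : Fin d → ℝ) c => H (r, c) := by
    intro r r' hrr'
    obtain ⟨M, ρ, z, hρ, hz, hT⟩ := htrans
      (Finset.univ.image fun c => X (r, c) - X (r', c)) {r, r'}
    refine hρ (by simp) (by simp) (hginj M (funext fun c => ?_))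
    rw [← hz r (by simp), ← hz r' (by simp), ← sub_eq_zero]
    have h1 := (hT _ (Finset.mem_image_of_mem _ (Finset.mem_univ c))).2
    simp only [map_sub, aeval_X] at h1
    exact h1 (sub_eq_zero.2 (congrFun hrr' c))
  refine ⟨fun r c => H (r, c), hinj, fun Q hQ => ?_⟩
  let a : Fin k → Fin d → ℝ := fun i => (Q.equivFinOfCardEq hQ.1).symm i
  have ha : Function.Injective a := Subtype.val_injective.comp (Equiv.injective _)
  have haQ : fimg a Finset.univ = Q := by
    ext q
    rw [mem_fimg]
    refine ⟨?_, fun hq => ⟨Q.equivFinOfCardEq hQ.1 ⟨q, hq⟩, Finset.mem_univ _, by simp [a]⟩⟩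
    rintro ⟨i, -, rfl⟩
    exact Subtype.property _
  let Θ : Equiv.Perm (Fin k) → MvPolynomial ((Fin d → ℝ) × Fin n) κ := fun σ =>
    rename (fun v : Fin k × Fin n => (a (σ v.1), v.2)) p₀
  obtain ⟨M, ρ, z, hρ, hz, hT⟩ := htrans {∏ σ, Θ σ} Q
  have hz0 : aeval z (∏ σ, Θ σ) = 0 := by
    obtain ⟨a', ha', himg, h0⟩ := hg M _ (fimg_mem_LEdges hQ hρ)
    rw [fimg_fimg] at himg
    rw [← haQ] at himg
    obtain ⟨σ, hσ⟩ := exists_perm_of_fimg_eq ha' himg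
    rw [map_prod]
    refine Finset.prod_eq_zero (Finset.mem_univ σ) ?_
    rw [aeval_rename, hp₀, ← h0]
    congr 2
    funext v
    rw [hσ]
    refine hz _ ?_ _
    exact Subtype.property _
  rw [hT _ (Finset.mem_singleton_self _), map_prod, Finset.prod_eq_zero_iff] at hz0
  obtain ⟨σ, -, hσ⟩ := hz0
  rw [aeval_rename, hp₀] at hσ
  refine ⟨fun i c => H (a (σ i), c), hinj.comp (ha.comp σ.injective), ?_, hσ⟩
  ext w
  conv_rhs => rw [← haQ, fimg_fimg]
  simp only [mem_fimg, Finset.mem_univ, true_and, Function.comp]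
  exact σ.exists_congr_left.trans (by simp)

theorem embeddable_LEdges_real_iff {k n d : ℕ} {p : MvPolynomial (Fin k × Fin n) ℝ} {α : Type*}
    {P : Finset (Fin d → α)} : Embeddable (LEdges k P ℝ) (zeroEdges k n p) ↔
      ∀ M : ℕ, Embeddable (LEdges k P (Fin M)) (zeroEdges k n p) :=
  ⟨fun h M => h.LEdges_of_injective (ι := fun i : Fin M => ((i : ℕ) : ℝ))
    (Nat.cast_injective.comp Fin.val_injective), embeddable_LEdges_real⟩

theorem eT_ne_zero {d : ℕ} {α : Type*} {P : Finset (Fin d → α)} (hP : 2 ≤ P.card) : eT P ≠ 0 := by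
  obtain ⟨x, hx, y, hy, hxy⟩ := Finset.one_lt_card.1 hP
  rw [eT, Ne, Nat.sInf_eq_zero, not_or]
  refine ⟨?_, Set.Nonempty.ne_empty ⟨_, Finset.univ, fun x _ y _ h => ?_, rfl⟩⟩
  · rintro ⟨I, hI, h0⟩
    obtain ⟨i, hi, -⟩ := hI x hx y hy hxy
    rw [Finset.card_eq_zero.1 h0] at hi
    exact Finset.notMem_empty i hi
  · obtain ⟨i, hi⟩ := Function.ne_iff.1 h
    exact ⟨i, Finset.mem_univ i, hi⟩

/-- Suppose `H` is an algebraic `k`-hypergraph and `δ = dep(H)`.  If `δ < ω` then `δ`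
is the least `δ'` for which there is a `d`-dimensional `k`-template `P` with
`e(P) = δ' + 1` such that `L(ℝ^d,P)` is embeddable into `H`.  If `δ = ∞` then there
is no template `P` with `L(ℝ^d,P)` embeddable into `H`. -/
theorem depth_characterization (k n : ℕ) (hk : 2 ≤ k)
    (p : MvPolynomial (Fin k × Fin n) ℝ) :
    (∀ δ : ℕ, IsLeast (DepthSet k (zeroEdges k n p)) δ →
      IsLeast {δ' : ℕ | ∃ (d : ℕ) (α : Type) (P : Finset (Fin d → α)),
        P.card = k ∧ eT P = δ' + 1 ∧ Embeddable (LEdges k P ℝ) (zeroEdges k n p)} δ) ∧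
    (DepthSet k (zeroEdges k n p) = ∅ →
      ∀ (d : ℕ) (α : Type) (P : Finset (Fin d → α)), P.card = k →
        ¬ Embeddable (LEdges k P ℝ) (zeroEdges k n p)) := by
  simp only [embeddable_LEdges_real_iff]
  refine ⟨fun δ h => h, fun h d α P hP hemb => ?_⟩
  refine Set.eq_empty_iff_forall_notMem.1 h (eT P - 1) ⟨d, α, P, hP, ?_, hemb⟩
  exact (Nat.succ_pred (eT_ne_zero (hP.symm ▸ hk))).symm
end

section
/- If H = (ℝ^n, E) is an algebraic k-hypergraph, then the following are equivalent: (1) for each m < ω, the complete k-hypergraph K^(k)_m on m vertices is embeddable into H; (2) there is an infinite algebraic set A ⊆ ℝ^n such that the complete k-hypergraph K^(k)_A on A is a subhypergraph of H, i.e., every k-element subset of A is an edge of H. -/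
open Cardinal

universe u v

/-- `A ⊆ ℝ^n` is an algebraic set: the common zero set of a set of real polynomials. -/
def IsAlgebraicSet (n : ℕ) (A : Set (Fin n → ℝ)) : Prop :=
  ∃ S : Set (MvPolynomial (Fin n) ℝ), A = {x | ∀ q ∈ S, MvPolynomial.eval x q = 0}

namespace MvPolynomial

/-- The restrictions to a finite set of all polynomials span all functions on it. -/
theorem exists_eval_eq_of_finset {n : ℕ} (T : Finset (Fin n → ℝ)) (f : T → ℝ) :
    ∃ p : MvPolynomial (Fin n) ℝ, ∀ x : T, eval x.1 p = f x := by
  classical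
  let δ : (Fin n → ℝ) → MvPolynomial (Fin n) ℝ := fun x =>
    ∏ y ∈ T.erase x, ∑ j, (X j - C (y j)) ^ 2
  have hself : ∀ x, eval x (δ x) ≠ 0 := by
    intro x
    simp only [δ, map_prod, map_sum, map_pow, map_sub, eval_X, eval_C]
    refine Finset.prod_ne_zero_iff.2 fun y hy h => (Finset.mem_erase.1 hy).1 ?_
    rw [Finset.sum_eq_zero_iff_of_nonneg fun _ _ => sq_nonneg _] at h
    ext j
    have := h j (Finset.mem_univ j)
    nlinarith [pow_eq_zero_iff (two_ne_zero) |>.1 this]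
  have hother : ∀ x, ∀ y ∈ T, y ≠ x → eval y (δ x) = 0 := by
    intro x y hy hyx
    simp only [δ, map_prod]
    exact Finset.prod_eq_zero (Finset.mem_erase.2 ⟨hyx, hy⟩) (by simp)
  refine ⟨∑ x : T, C (f x / eval x.1 (δ x)) * δ x, fun x => ?_⟩
  rw [map_sum, Finset.sum_eq_single x]
  · simp [hself]
  · intro y _ hyx
    rw [map_mul, hother y x x.2 fun h => hyx (Subtype.ext h.symm), mul_zero]
  · simp

/-- A system `X i ^ e = r i` whose right-hand sides have degree less than `e` has at most `e ^ n`
solutions: modulo the system, every polynomial reduces to monomials with all exponents below `e`. -/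
theorem card_le_pow_of_pow_eq_eval {n e : ℕ} {r : Fin n → MvPolynomial (Fin n) ℝ}
    (hr : ∀ i, (r i).totalDegree < e) (T : Finset (Fin n → ℝ))
    (hT : ∀ x ∈ T, ∀ i, x i ^ e = eval x (r i)) : T.card ≤ e ^ n := by
  classical
  let v : (Fin n → Fin e) → T → ℝ := fun α x => ∏ i, x.1 i ^ (α i : ℕ)
  let W := Submodule.span ℝ (Set.range v)
  have hW : ∀ N : ℕ, ∀ p : MvPolynomial (Fin n) ℝ, p.totalDegree < N →
      (fun x : T => eval x.1 p) ∈ W := by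
    intro N
    induction N with
    | zero => intro p hp; omega
    | succ N ih =>
      intro p hp
      have hsum : (fun x : T => eval x.1 p) =
          ∑ s ∈ p.support, fun x : T => eval x.1 (monomial s (coeff s p)) := by
        ext x
        conv_lhs => rw [p.as_sum]
        simp only [map_sum, Finset.sum_apply]
      rw [hsum]
      refine Submodule.sum_mem _ fun s hs => ?_
      by_cases hlt : ∀ i, s i < e
      · have : (fun x : T => eval x.1 (monomial s (coeff s p))) =
            coeff s p • v fun i => ⟨s i, hlt i⟩ := by
          ext x
          simp [v, eval_monomial, Finsupp.prod_fintype]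
        rw [this]
        exact Submodule.smul_mem _ _ (Submodule.subset_span ⟨_, rfl⟩)
      · push Not at hlt
        obtain ⟨i, hi⟩ := hlt
        have hle : Finsupp.single i e ≤ s := by simpa using hi
        have hsplit : s - Finsupp.single i e + Finsupp.single i e = s := tsub_add_cancel_of_le hle
        have : (fun x : T => eval x.1 (monomial s (coeff s p))) = fun x : T =>
            eval x.1 (monomial (s - Finsupp.single i e) (coeff s p) * r i) := by
          ext x
          rw [map_mul, ← hT x x.2 i, ← hsplit, add_tsub_cancel_right, ← mul_one (coeff _ p),
            ← monomial_mul, map_mul]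
          simp [eval_monomial]
        rw [this]
        refine ih _ ?_
        have h1 := totalDegree_mul (monomial (s - Finsupp.single i e) (coeff s p)) (r i)
        have h2 := totalDegree_monomial_le (s - Finsupp.single i e) (coeff s p)
        have h3 := le_totalDegree hs
        have h4 := hr i
        have h5 : (s.sum fun _ a => a) = ((s - Finsupp.single i e).sum fun _ a => a) + e := by
          conv_lhs => rw [← hsplit]
          rw [Finsupp.sum_add_index' (fun _ => rfl) fun _ _ _ => rfl, Finsupp.sum_single_index rfl]
        simp only [Function.id_def] at h2
        omega
  have htop : W = ⊤ := by
    refine eq_top_iff.2 fun f _ => ?_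
    obtain ⟨p, hp⟩ := exists_eval_eq_of_finset T f
    rw [show f = fun x : T => eval x.1 p from _root_.funext fun x => (hp x).symm]
    exact hW _ p (Nat.lt_succ_self _)
  have h : Module.finrank ℝ W ≤ Fintype.card (Fin n → Fin e) := finrank_range_le_card v
  rw [htop, finrank_top] at h
  simpa using h

theorem totalDegree_pderiv_le {σ : Type*} (i : σ) (p : MvPolynomial σ ℝ) :
    (pderiv i p).totalDegree ≤ p.totalDegree := by
  classical
  conv_lhs => rw [p.as_sum]
  rw [map_sum]
  refine totalDegree_finsetSum_le fun s hs => ?_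
  rw [pderiv_monomial]
  refine (totalDegree_monomial_le _ _).trans ((Finsupp.sum_le_sum_index ?_ ?_ ?_).trans
    (le_totalDegree hs))
  · exact tsub_le_self
  · exact fun _ _ => monotone_id
  · exact fun _ _ => rfl

theorem hasDerivAt_eval_update {σ : Type*} [DecidableEq σ] (i : σ) (p : MvPolynomial σ ℝ)
    (x : σ → ℝ) (t : ℝ) :
    HasDerivAt (fun t => eval (Function.update x i t) p)
      (eval (Function.update x i t) (pderiv i p)) t := by
  induction p using MvPolynomial.induction_on with
  | C a => simpa using hasDerivAt_const t a
  | add p q hp hq => simpa using! hp.add hq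
  | mul_X p j hp =>
    have hX : HasDerivAt (fun t => Function.update x i t j) (Pi.single (M := fun _ => ℝ) i 1 j) t := by
      by_cases hj : j = i
      · subst hj; simpa using! hasDerivAt_id t
      · simpa [hj] using hasDerivAt_const t (x j)
    have := hp.mul hX
    have hval : eval (Function.update x i t) (pderiv i (p * X j)) =
        eval (Function.update x i t) (pderiv i p) * Function.update x i t j +
          eval (Function.update x i t) p * Pi.single (M := fun _ => ℝ) i 1 j := by
      by_cases hj : j = i
      · subst hj; simp [Derivation.leibniz]; ring
      · simp [Derivation.leibniz, hj]; ring
    rw [hval]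
    simpa using! this

theorem eval_pderiv_eq_zero_of_isLocalMin {n : ℕ} {p : MvPolynomial (Fin n) ℝ} {x : Fin n → ℝ}
    (h : IsLocalMin (fun y => eval y p) x) (i : Fin n) : eval x (pderiv i p) = 0 := by
  have hc : ContinuousAt (fun t => Function.update x i t) (x i) := by fun_prop
  have hmin : IsLocalMin (fun t => eval (Function.update x i t) p) (x i) := by
    have := hc.tendsto
    rw [Function.update_eq_self] at this
    simpa [IsLocalMin, IsMinFilter] using this.eventually h
  simpa using hmin.hasDerivAt_eq_zero (hasDerivAt_eval_update i p x (x i))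

open Filter Topology in
/-- The number of zeros of a nonnegative polynomial of degree at most `2 * d` with finitely many
zeros is bounded in terms of `d` and the number of variables: near each zero, a small perturbation
by `∑ i, X i ^ (2 * d + 2)` has a critical point. -/
theorem card_zeros_le_of_nonneg {n d : ℕ} {f : MvPolynomial (Fin n) ℝ}
    (hf : ∀ x, 0 ≤ eval x f) (hd : f.totalDegree ≤ 2 * d) (T : Finset (Fin n → ℝ))
    (hT : ∀ x, x ∈ T ↔ eval x f = 0) : T.card ≤ (2 * d + 1) ^ n := by
  classical
  obtain ⟨U, hU, hdisj⟩ := T.finite_toSet.t2_separation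
  have hball : ∀ a, ∃ ρ > 0, Metric.closedBall a ρ ⊆ U a := fun a =>
    Metric.nhds_basis_closedBall.mem_iff.1 ((hU a).2.mem_nhds (hU a).1)
  choose ρ hρ hρU using hball
  have hsphere : ∀ a ∈ T, ∃ m > 0, ∀ y ∈ Metric.sphere a (ρ a), m ≤ eval y f := by
    intro a ha
    refine (isCompact_sphere a (ρ a)).exists_forall_le' (continuous_eval f).continuousOn ?_
    refine fun y hy => (hf y).lt_of_ne fun h => ?_
    have hyT : y ∈ T := (hT y).2 h.symm
    have hya : a ≠ y := by
      rintro rfl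
      simp [(hρ a).ne] at hy
    exact Set.disjoint_left.1 (hdisj ha hyT hya)
      (hρU a (Metric.sphere_subset_closedBall hy)) (hU y).1
  choose! m hm hmle using hsphere
  let h : MvPolynomial (Fin n) ℝ := ∑ i, X i ^ (2 * d + 2)
  have hnonneg : ∀ x, 0 ≤ eval x h := fun x => by
    simp only [h, map_sum, map_pow, eval_X]
    exact Finset.sum_nonneg fun i _ => Even.pow_nonneg ⟨d + 1, by ring⟩ _
  obtain ⟨ε, hεm, hε⟩ : ∃ ε : ℝ, (∀ a ∈ T, ε * eval a h < m a) ∧ 0 < ε := by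
    have h1 : ∀ a ∈ T, ∀ᶠ ε : ℝ in 𝓝[>] 0, ε * eval a h < m a := fun a ha => by
      have : Tendsto (fun ε : ℝ => ε * eval a h) (𝓝[>] 0) (𝓝 (0 * eval a h)) :=
        (Continuous.tendsto (by fun_prop) 0).mono_left nhdsWithin_le_nhds
      rw [zero_mul] at this
      exact this.eventually (gt_mem_nhds (hm a ha))
    exact (((eventually_all_finset T).2 h1).and self_mem_nhdsWithin).exists
  have hcrit : ∀ a ∈ T, ∃ z ∈ U a, ∀ i, eval z (pderiv i (f + C ε * h)) = 0 := by
    intro a ha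
    obtain ⟨z, hz, hzmin⟩ := (isCompact_closedBall a (ρ a)).exists_isMinOn
      ⟨a, Metric.mem_closedBall_self (hρ a).le⟩ (continuous_eval (f + C ε * h)).continuousOn
    refine ⟨z, hρU a hz, fun i => eval_pderiv_eq_zero_of_isLocalMin (hzmin.isLocalMin ?_) i⟩
    have hza : z ∈ Metric.ball a (ρ a) := by
      refine lt_of_le_of_ne (Metric.mem_closedBall.1 hz) fun heq => ?_
      have h1 : eval z (f + C ε * h) ≤ eval a (f + C ε * h) :=
        hzmin (Metric.mem_closedBall_self (hρ a).le)
      simp only [map_add, map_mul, eval_C, (hT a).1 ha] at h1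
      nlinarith [hmle a ha z heq, hεm a ha, mul_nonneg hε.le (hnonneg z)]
    exact Filter.mem_of_superset (Metric.isOpen_ball.mem_nhds hza) Metric.ball_subset_closedBall
  choose! z hzU hz using hcrit
  have hinj : Set.InjOn z T := by
    intro a ha b hb hab
    by_contra hne
    exact Set.disjoint_left.1 (hdisj ha hb hne) (hzU a ha) (hab ▸ hzU b hb)
  rw [← Finset.card_image_of_injOn hinj]
  refine card_le_pow_of_pow_eq_eval
    (r := fun i => C (-(ε * (2 * d + 2))⁻¹) * pderiv i f) (fun i => ?_) _ fun x hx i => ?_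
  · have h1 := totalDegree_mul (C (-(ε * (2 * d + 2))⁻¹)) (pderiv i f)
    have h2 := totalDegree_pderiv_le i f
    rw [totalDegree_C] at h1
    omega
  · obtain ⟨a, ha, rfl⟩ := Finset.mem_image.1 hx
    have h1 := hz a ha i
    have h2 : pderiv i h = C (2 * d + 2 : ℝ) * X i ^ (2 * d + 1) := by
      simp only [h, map_sum, Derivation.leibniz_pow, pderiv_X]
      rw [Finset.sum_eq_single i]
      · simp
        rfl
      · intro b _ hb
        simp [hb]
      · simp
    rw [map_add, pderiv_C_mul, h2] at h1
    simp only [map_add, map_mul, eval_C, map_pow, eval_X] at h1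
    have : ε * (2 * d + 2) ≠ 0 := by positivity
    rw [map_mul, eval_C]
    field_simp
    linarith
end MvPolynomial

namespace MvPolynomial

theorem totalDegree_aeval_le_of_le_one {σ τ : Type*} [Fintype σ] (g : σ → MvPolynomial τ ℝ)
    (hg : ∀ v, (g v).totalDegree ≤ 1) (q : MvPolynomial σ ℝ) :
    (aeval g q).totalDegree ≤ q.totalDegree := by
  rw [aeval_def, eval₂_eq']
  refine totalDegree_finsetSum_le fun s hs => ?_
  have h1 := totalDegree_mul (algebraMap ℝ (MvPolynomial τ ℝ) (coeff s q)) (∏ i, g i ^ s i)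
  rw [algebraMap_eq, totalDegree_C, zero_add] at h1
  refine h1.trans ((totalDegree_finsetProd _ _).trans (le_trans ?_ (le_totalDegree hs)))
  rw [Finsupp.sum_fintype _ _ fun _ => rfl]
  refine Finset.sum_le_sum fun i _ => (totalDegree_pow _ _).trans ?_
  exact (Nat.mul_le_mul_left _ (hg i)).trans_eq (mul_one _)

/-- Polynomials of degree at most `d` vanishing on `B`. -/
noncomputable def boundedVanishing (n d : ℕ) (B : Set (Fin n → ℝ)) :
    Submodule ℝ (MvPolynomial (Fin n) ℝ) where
  carrier := {v | v.totalDegree ≤ d ∧ ∀ x ∈ B, eval x v = 0}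
  zero_mem' := by simp
  add_mem' := fun {v w} hv hw =>
    ⟨(totalDegree_add v w).trans (max_le hv.1 hw.1), fun x hx => by
      rw [map_add, hv.2 x hx, hw.2 x hx, add_zero]⟩
  smul_mem' := fun c v hv =>
    ⟨(totalDegree_smul_le c v).trans hv.1, fun x hx => by rw [smul_eval, hv.2 x hx, mul_zero]⟩

theorem boundedVanishing_le_restrictTotalDegree (n d : ℕ) (B : Set (Fin n → ℝ)) :
    boundedVanishing n d B ≤ restrictTotalDegree (Fin n) ℝ d :=
  fun v hv => (mem_restrictTotalDegree _ _ v).2 hv.1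

theorem boundedVanishing_anti {n d : ℕ} {B B' : Set (Fin n → ℝ)} (h : B ⊆ B') :
    boundedVanishing n d B' ≤ boundedVanishing n d B :=
  fun _ hv => ⟨hv.1, fun x hx => hv.2 x (h hx)⟩

instance (n d : ℕ) (B : Set (Fin n → ℝ)) : Module.Finite ℝ (boundedVanishing n d B) :=
  Submodule.finiteDimensional_of_le (boundedVanishing_le_restrictTotalDegree n d B)

/-- Every finite set contains a subset, smaller by at most a constant, whose polynomials of degree
at most `d` are not affected by the removal of any `k` points. -/
theorem exists_stable_subset (n d k : ℕ) (B : Finset (Fin n → ℝ)) :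
    ∃ B' ⊆ B, B.card ≤ B'.card + (k + 1) * Module.finrank ℝ (restrictTotalDegree (Fin n) ℝ d) ∧
      ∀ C ⊆ B', B'.card ≤ C.card + k →
        boundedVanishing n d C ≤ boundedVanishing n d (B' : Set (Fin n → ℝ)) := by
  obtain ⟨B', hB', hmax⟩ := B.powerset.exists_max_image
    (fun C => C.card + (k + 1) * Module.finrank ℝ (boundedVanishing n d (C : Set (Fin n → ℝ))))
    ⟨B, by simp⟩
  rw [Finset.mem_powerset] at hB'
  refine ⟨B', hB', ?_, fun C hC hcard => ?_⟩
  · have h1 := hmax B (by simp)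
    have h2 := Nat.mul_le_mul_left (k + 1) (Submodule.finrank_mono
      (boundedVanishing_le_restrictTotalDegree n d (B' : Set (Fin n → ℝ))))
    omega
  · have hle : boundedVanishing n d (B' : Set (Fin n → ℝ)) ≤ boundedVanishing n d C :=
      boundedVanishing_anti (by exact_mod_cast hC)
    refine (Submodule.eq_of_le_of_finrank_le hle ?_).ge
    have h1 := hmax C (by simpa using hC.trans hB')
    by_contra! h
    have h2 := Nat.mul_le_mul_left (k + 1) (Nat.succ_le_of_lt h)
    rw [Nat.succ_eq_add_one, mul_add] at h2
    omega

/-- The common zero set of polynomials of degree at most `d` is infinite as soon as it has more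
than `(2 * d + 1) ^ n` points. -/
theorem infinite_zeros_of_card_lt {n d : ℕ} (I : Submodule ℝ (MvPolynomial (Fin n) ℝ))
    [Module.Finite ℝ I] (hd : ∀ v ∈ I, v.totalDegree ≤ d) (B : Finset (Fin n → ℝ))
    (hB : ∀ x ∈ B, ∀ v ∈ I, eval x v = 0) (hcard : (2 * d + 1) ^ n < B.card) :
    {x : Fin n → ℝ | ∀ v ∈ I, eval x v = 0}.Infinite := by
  classical
  intro hfin
  obtain ⟨S, hS⟩ := (Module.Finite.iff_fg.1 ‹Module.Finite ℝ I› : I.FG)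
  have hSI : ∀ v ∈ S, v ∈ I := fun v hv => hS ▸ Submodule.subset_span hv
  have hnonneg : ∀ x : Fin n → ℝ, 0 ≤ eval x (∑ v ∈ S, v ^ 2) := fun x => by
    simp only [map_sum, map_pow]
    exact Finset.sum_nonneg fun _ _ => sq_nonneg _
  have hzero : ∀ x, x ∈ hfin.toFinset ↔ eval x (∑ v ∈ S, v ^ 2) = 0 := fun x => by
    rw [Set.Finite.mem_toFinset, Set.mem_ofPred_eq, map_sum]
    simp only [map_pow]
    rw [Finset.sum_eq_zero_iff_of_nonneg fun _ _ => sq_nonneg _]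
    simp only [sq_eq_zero_iff]
    refine ⟨fun h v hv => h v (hSI v hv), fun h v hv => ?_⟩
    rw [← hS] at hv
    induction hv using Submodule.span_induction with
    | mem v hv => exact h v hv
    | zero => simp
    | add v w _ _ hv hw => rw [map_add, hv, hw, add_zero]
    | smul c v _ hv => rw [smul_eval, hv, mul_zero]
  have hdeg : (∑ v ∈ S, v ^ 2).totalDegree ≤ 2 * d := totalDegree_finsetSum_le fun v hv =>
    (totalDegree_pow v 2).trans (Nat.mul_le_mul_left 2 (hd v (hSI v hv)))
  have h1 := card_zeros_le_of_nonneg hnonneg hdeg _ hzero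
  have h2 : B ⊆ hfin.toFinset := fun x hx => hfin.mem_toFinset.2 (hB x hx)
  have := Finset.card_le_card h2
  omega

theorem eval_eq_zero_of_stable {k n : ℕ} {q : MvPolynomial (Fin k × Fin n) ℝ}
    {B : Finset (Fin n → ℝ)}
    (hq : ∀ x : Fin k → Fin n → ℝ, (∀ i, x i ∈ B) → Function.Injective x →
      eval (fun v => x v.1 v.2) q = 0)
    (hB : ∀ C ⊆ B, B.card ≤ C.card + k → boundedVanishing n q.totalDegree C ≤
      boundedVanishing n q.totalDegree (B : Set (Fin n → ℝ)))
    (x : Fin k → Fin n → ℝ)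
    (hx : ∀ i, ∀ v ∈ boundedVanishing n q.totalDegree (B : Set (Fin n → ℝ)), eval (x i) v = 0) :
    eval (fun v => x v.1 v.2) q = 0 := by
  classical
  suffices H : ∀ S : Finset (Fin k), ∀ x : Fin k → Fin n → ℝ,
      (∀ i ∈ S, ∀ v ∈ boundedVanishing n q.totalDegree (B : Set (Fin n → ℝ)), eval (x i) v = 0) →
      (∀ i ∉ S, x i ∈ B) → Set.InjOn x {i | i ∉ S} → eval (fun v => x v.1 v.2) q = 0 from
    H Finset.univ x (fun i _ => hx i) (by simp) (by simp)
  intro S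
  induction S using Finset.induction_on with
  | empty =>
    intro x _ hx hinj
    exact hq x (fun i => hx i (Finset.notMem_empty i)) fun i j => hinj (by simp) (by simp)
  | insert i S hi ih =>
    intro x hxS hxB hinj
    let w : MvPolynomial (Fin n) ℝ :=
      aeval (fun v : Fin k × Fin n => if v.1 = i then X v.2 else C (x v.1 v.2)) q
    have hw : ∀ y, eval y w = eval (fun v => Function.update x i y v.1 v.2) q := by
      intro y
      have : (eval y).comp (aeval (R := ℝ) fun v : Fin k × Fin n =>
          if v.1 = i then X v.2 else C (x v.1 v.2)).toRingHom =
          eval (fun v => Function.update x i y v.1 v.2) := by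
        refine ringHom_ext (fun r => by simp) fun v => ?_
        by_cases hv : v.1 = i <;> simp [hv]
      exact congrArg (fun φ : MvPolynomial (Fin k × Fin n) ℝ →+* ℝ => φ q) this
    have hdeg : w.totalDegree ≤ q.totalDegree := totalDegree_aeval_le_of_le_one _
      (fun v => by split_ifs <;> simp [totalDegree_X]) q
    have hcard : B.card ≤ (B \ Finset.univ.image x).card + k := by
      have h1 := Finset.le_card_sdiff (Finset.univ.image x) B
      have h2 := (Finset.card_image_le (s := Finset.univ) (f := x))
      rw [Finset.card_univ, Fintype.card_fin] at h2
      omega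
    have hmem := hB (B \ Finset.univ.image x) Finset.sdiff_subset hcard (x := w)
      ⟨hdeg, fun y hy => ?_⟩
    · have := hxS i (Finset.mem_insert_self i S) w hmem
      rwa [hw, Function.update_eq_self] at this
    · rw [Finset.mem_coe, Finset.mem_sdiff] at hy
      have hne : ∀ j, x j ≠ y := fun j hj =>
        hy.2 (Finset.mem_image.2 ⟨j, Finset.mem_univ j, hj⟩)
      rw [hw]
      refine ih _ (fun j hj => ?_) (fun j hj => ?_) fun j hj l hl hjl => ?_
      · rw [Function.update_of_ne (by rintro rfl; exact hi hj)]
        exact hxS j (Finset.mem_insert_of_mem hj)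
      · by_cases hji : j = i
        · subst hji
          simpa using hy.1
        · rw [Function.update_of_ne hji]
          exact hxB j (by simp [hji, hj])
      · by_cases hji : j = i <;> by_cases hli : l = i
        · rw [hji, hli]
        · subst hji
          rw [Function.update_self, Function.update_of_ne hli] at hjl
          exact absurd hjl.symm (hne l)
        · subst hli
          rw [Function.update_self, Function.update_of_ne hji] at hjl
          exact absurd hjl (hne j)
        · rw [Function.update_of_ne hji, Function.update_of_ne hli] at hjl
          exact hinj (by simpa [hji] using hj) (by simpa [hli] using hl) hjl

/-- The product of all polynomials obtained from `p` by permuting its blocks of variables. -/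
noncomputable def blockSymm {k n : ℕ} (p : MvPolynomial (Fin k × Fin n) ℝ) :
    MvPolynomial (Fin k × Fin n) ℝ :=
  ∏ σ : Equiv.Perm (Fin k), rename (Prod.map σ id) p

end MvPolynomial

theorem card_fimg {V W : Type*} {g : V → W} (hg : Function.Injective g) (e : Finset V) :
    (fimg g e).card = e.card :=
  letI := Classical.decEq W
  Finset.card_image_of_injective e hg

theorem fimg_univ_mem_zeroEdges_iff {k n : ℕ} {p : MvPolynomial (Fin k × Fin n) ℝ}
    {a : Fin k → Fin n → ℝ} (ha : Function.Injective a) :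
    fimg a Finset.univ ∈ zeroEdges k n p ↔
      MvPolynomial.eval (fun v => a v.1 v.2) (MvPolynomial.blockSymm p) = 0 := by
  have heval : ∀ σ : Equiv.Perm (Fin k),
      MvPolynomial.eval (fun v => a v.1 v.2) (MvPolynomial.rename (Prod.map σ id) p) =
        MvPolynomial.eval (fun v => a (σ v.1) v.2) p := fun σ => by
    rw [MvPolynomial.eval_rename]
    rfl
  simp only [MvPolynomial.blockSymm, map_prod, Finset.prod_eq_zero_iff, heval, Finset.mem_univ,
    true_and]
  constructor
  · rintro ⟨b, hb, hba, hp⟩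
    have hmem : ∀ i, ∃ j, a j = b i := fun i => by
      have : b i ∈ fimg a Finset.univ := hba ▸ mem_fimg.2 ⟨i, Finset.mem_univ i, rfl⟩
      simpa using mem_fimg.1 this
    choose σ hσ using hmem
    have hinj : Function.Injective σ := fun i j hij => hb (by rw [← hσ, ← hσ, hij])
    refine ⟨Equiv.ofBijective σ (Finite.injective_iff_bijective.1 hinj), ?_⟩
    simpa [hσ] using hp
  · rintro ⟨σ, hσ⟩
    refine ⟨a ∘ σ, ha.comp σ.injective, ?_, hσ⟩
    ext w
    simp only [mem_fimg, Finset.mem_univ, true_and, Function.comp_apply]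
    exact σ.surjective.exists (p := fun j => a j = w) |>.symm

/-- For an algebraic `k`-hypergraph `H = (ℝ^n, E)`, the complete `k`-hypergraph on `m`
vertices embeds into `H` for every `m < ω` iff there is an infinite algebraic set
`A ⊆ ℝ^n` all of whose `k`-element subsets are edges of `H`. -/
theorem complete_embeddable_iff_algebraic_clique (k n : ℕ)
    (p : MvPolynomial (Fin k × Fin n) ℝ) :
    (∀ m : ℕ, Embeddable {s : Finset (Fin m) | s.card = k} (zeroEdges k n p)) ↔
    ∃ A : Set (Fin n → ℝ), A.Infinite ∧ IsAlgebraicSet n A ∧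
      ∀ s : Finset (Fin n → ℝ), ↑s ⊆ A → s.card = k → s ∈ zeroEdges k n p := by
  classical
  constructor
  · intro h
    set q := MvPolynomial.blockSymm p
    set d := q.totalDegree
    obtain ⟨g, hg, hedge⟩ := h ((2 * d + 1) ^ n + 1 +
      (k + 1) * Module.finrank ℝ (MvPolynomial.restrictTotalDegree (Fin n) ℝ d))
    obtain ⟨B, hBsub, hBcard, hBstable⟩ :=
      MvPolynomial.exists_stable_subset n d k (fimg g Finset.univ)
    rw [card_fimg hg, Finset.card_univ, Fintype.card_fin] at hBcard
    have hq : ∀ x : Fin k → Fin n → ℝ, (∀ i, x i ∈ B) → Function.Injective x →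
        MvPolynomial.eval (fun v => x v.1 v.2) q = 0 := by
      intro x hxB hx
      have hex : ∀ i, ∃ j, g j = x i := fun i => by simpa using mem_fimg.1 (hBsub (hxB i))
      choose y hy using hex
      have hyinj : Function.Injective y := fun i j hij => hx (by rw [← hy, ← hy, hij])
      have := hedge (fimg y Finset.univ) (by simp [card_fimg hyinj])
      rw [← fimg_univ_mem_zeroEdges_iff hx]
      convert this using 1
      ext w
      simp [mem_fimg, hy]
    refine ⟨{x | ∀ v ∈ MvPolynomial.boundedVanishing n d (B : Set (Fin n → ℝ)),
      MvPolynomial.eval x v = 0}, ?_, ⟨MvPolynomial.boundedVanishing n d B, rfl⟩, ?_⟩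
    · exact MvPolynomial.infinite_zeros_of_card_lt _ (fun v hv => hv.1) B
        (fun x hx v hv => hv.2 x hx) (by omega)
    · intro s hsA hs
      let a : Fin k → Fin n → ℝ := fun i => (s.equivFinOfCardEq hs).symm i
      have ha : Function.Injective a :=
        Subtype.val_injective.comp (s.equivFinOfCardEq hs).symm.injective
      have hsa : fimg a Finset.univ = s := by
        ext w
        simp only [mem_fimg, Finset.mem_univ, true_and, a]
        exact ⟨by rintro ⟨i, rfl⟩; exact Subtype.prop _,
          fun hw => ⟨s.equivFinOfCardEq hs ⟨w, hw⟩, by simp⟩⟩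
      rw [← hsa, fimg_univ_mem_zeroEdges_iff ha]
      exact MvPolynomial.eval_eq_zero_of_stable hq hBstable a
        fun i => hsA (Subtype.prop _)
  · rintro ⟨A, hA, -, hedge⟩ m
    have := hA.to_subtype
    let g : Fin m → Fin n → ℝ := fun i => Infinite.natEmbedding A i
    have hg : Function.Injective g :=
      Subtype.val_injective.comp ((Infinite.natEmbedding A).injective.comp Fin.val_injective)
    refine ⟨g, hg, fun e he => hedge _ ?_ ((card_fimg hg e).trans he)⟩
    intro w hw
    obtain ⟨i, _, rfl⟩ := mem_fimg.1 (Finset.mem_coe.1 hw)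
    exact Subtype.prop _
end
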